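/- arXiv:1202.1213 — 3 statements merged into one kernel-verified Lean document; each statement's English description precedes it below -/
import Mathlib

section
/- Let Γ be a countable discrete amenable group, let d ≥ 1, let J ⊆ (ℤΓ)^{1×d} be an arbitrary set of row vectors over the integral group ring, and let ε > 0. Then limsup_F (log N_{4ε}(X_{J,F}, ϑ_{F,∞}))/|F| ≤ limsup_F (log N_ε(X_J, ϑ_{F,∞}))/|F| ≤ limsup_F (log N_ε(X_{J,F}, ϑ_{F,∞}))/|F|, where limsup_F denotes the limit superior as the nonempty finite subset F of Γ becomes more and more left invariant. -/
/-- The supremum of cardinalities of subsets of `Z` that are pairwise `sep`-separated. -/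
noncomputable def sepCount {P : Type*} (Z : Set P) (sep : P → P → Prop) : ℕ :=
  sSup {n : ℕ | ∃ W : Finset P, ↑W ⊆ Z ∧ (∀ x ∈ W, ∀ y ∈ W, x ≠ y → sep x y) ∧ W.card = n}

/-- `F` belongs to `B(K, δ)`: `F` is a nonempty finite subset of `Γ` such that
`|{t ∈ F : Kt ⊆ F}| ≥ (1 − δ)|F|`. -/
def memApproxInv {Γ : Type*} [Group Γ] [DecidableEq Γ] (K : Finset Γ) (δ : ℝ)
    (F : Finset Γ) : Prop :=
  F.Nonempty ∧ (1 - δ) * (F.card : ℝ) ≤ ((F.filter fun t => ∀ k ∈ K, k * t ∈ F).card : ℝ)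

/-- The limit superior of `ψ(F)` as the nonempty finite subset `F ⊆ Γ` becomes more and
more left invariant: `inf_{(K,δ)} sup_{F ∈ B(K,δ)} ψ(F)`. -/
noncomputable def limsupFolner {Γ : Type*} [Group Γ] [DecidableEq Γ]
    (ψ : Finset Γ → ℝ) : ℝ :=
  ⨅ p : {p : Finset Γ × ℝ // p.1.Nonempty ∧ 0 < p.2},
    ⨆ F : {F : Finset Γ // memApproxInv p.1.1 p.1.2 F}, ψ F.1

/-- The evaluation `(f x)_t = Σ_{s,j} f_{s,j} x_{s⁻¹ t, j}` of a row `f ∈ (ℤΓ)^{1×d}` on a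
point `x ∈ ((ℝ/ℤ)^d)^Γ`. -/
noncomputable def rowEval {Γ : Type*} [Group Γ] {d : ℕ} (f : Γ → Fin d → ℤ)
    (x : Γ → Fin d → AddCircle (1 : ℝ)) (t : Γ) : AddCircle (1 : ℝ) :=
  ∑ᶠ s : Γ, ∑ j : Fin d, f s j • x (s⁻¹ * t) j

/-- `X_J`: the set of `x ∈ ((ℝ/ℤ)^d)^Γ` with `f x = 0` for every `f ∈ J`. -/
def XJ {Γ : Type*} [Group Γ] {d : ℕ} (J : Set (Γ → Fin d → ℤ)) :
    Set (Γ → Fin d → AddCircle (1 : ℝ)) :=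
  {x | ∀ f ∈ J, ∀ t : Γ, rowEval f x t = 0}

/-- `X_{J,F}`: the set of `x ∈ ((ℝ/ℤ)^d)^Γ` with `(f x)_t = 0` for all `f ∈ J`, `t ∈ F`. -/
def XJF {Γ : Type*} [Group Γ] {d : ℕ} (J : Set (Γ → Fin d → ℤ)) (F : Finset Γ) :
    Set (Γ → Fin d → AddCircle (1 : ℝ)) :=
  {x | ∀ f ∈ J, ∀ t ∈ F, rowEval f x t = 0}

/-- `ϑ_{F,∞}(x,y) > ε`: some coordinate `(s,j)` with `s ∈ F` has `ϑ(x_{s,j}, y_{s,j}) > ε`,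
where `ϑ` is the standard metric on `ℝ/ℤ`. -/
def thetaInfSep {Γ : Type*} [Group Γ] {d : ℕ} (ε : ℝ) (F : Finset Γ)
    (x y : Γ → Fin d → AddCircle (1 : ℝ)) : Prop :=
  ∃ s ∈ F, ∃ j : Fin d, ε < dist (x s j) (y s j)

section Helpers

variable {Γ : Type*} [Group Γ] [DecidableEq Γ]

lemma memApproxInv.mono' {K₁ K₂ : Finset Γ} {δ₁ δ₂ : ℝ} {F : Finset Γ}
    (h : memApproxInv K₁ δ₁ F) (hK : K₂ ⊆ K₁) (hδ : δ₁ ≤ δ₂) : memApproxInv K₂ δ₂ F := by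
  refine ⟨h.1, ?_⟩
  have h2 := h.2
  have h3 : (F.filter fun t => ∀ k ∈ K₁, k * t ∈ F).card ≤
      (F.filter fun t => ∀ k ∈ K₂, k * t ∈ F).card := by
    apply Finset.card_le_card
    intro t ht
    simp only [Finset.mem_filter] at ht ⊢
    exact ⟨ht.1, fun k hk => ht.2 k (hK hk)⟩
  have h4 : ((F.filter fun t => ∀ k ∈ K₁, k * t ∈ F).card : ℝ) ≤
      (F.filter fun t => ∀ k ∈ K₂, k * t ∈ F).card := by exact_mod_cast h3
  have h5 : (0 : ℝ) ≤ F.card := by positivity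
  nlinarith

/-- the translate `A c` -/
def trans' (A : Finset Γ) (c : Γ) : Finset Γ := A.image (fun a => a * c)

lemma card_trans' (A : Finset Γ) (c : Γ) : (trans' A c).card = A.card :=
  Finset.card_image_of_injective _ (mul_left_injective c)

lemma mem_trans' {A : Finset Γ} {c t : Γ} : t ∈ trans' A c ↔ t * c⁻¹ ∈ A := by
  unfold trans'
  simp only [Finset.mem_image]
  constructor
  · rintro ⟨a, ha, rfl⟩; simpa using ha
  · intro h; exact ⟨_, h, by simp⟩

/-- greedy choice of almost disjoint translates -/
lemma greedy (A F I : Finset Γ) (hA : A.Nonempty) (η : ℝ) (hη : 0 < η) (hη1 : η ≤ 1 / 2)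
    (hI : ∀ c ∈ I, trans' A c ⊆ F) (hIF : (F.card : ℝ) / 2 ≤ I.card) :
    ∃ C : Finset Γ, C ⊆ I ∧
      (1 - η) * (C.card * A.card : ℝ) ≤ ((C.biUnion (trans' A)).card : ℝ) ∧
      η / 2 * (F.card : ℝ) ≤ ((C.biUnion (trans' A)).card : ℝ) := by
  classical
  let S := I.powerset.filter
    (fun C => (1 - η) * (C.card * A.card : ℝ) ≤ ((C.biUnion (trans' A)).card : ℝ))
  have hS : S.Nonempty := ⟨∅, by simp [S]⟩
  obtain ⟨C, hC, hmax⟩ := Finset.exists_max_image S Finset.card hS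
  simp only [S, Finset.mem_filter, Finset.mem_powerset] at hC hmax
  refine ⟨C, hC.1, hC.2, ?_⟩
  set U := C.biUnion (trans' A) with hU
  have hApos : (0 : ℝ) < A.card := by exact_mod_cast hA.card_pos
  have key : ∀ c ∈ I, η * (A.card : ℝ) ≤ ((trans' A c ∩ U).card : ℝ) := by
    intro c hc
    by_cases hcC : c ∈ C
    · have : trans' A c ∩ U = trans' A c :=
        Finset.inter_eq_left.2 (Finset.subset_biUnion_of_mem _ hcC)
      rw [this, card_trans']
      nlinarith
    · by_contra hlt
      push Not at hlt
      have hb : (insert c C).biUnion (trans' A) = trans' A c ∪ U := by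
        rw [Finset.biUnion_insert]
      have hcard : ((trans' A c ∪ U).card : ℝ) + (trans' A c ∩ U).card = A.card + U.card := by
        rw [← card_trans' A c]; exact_mod_cast Finset.card_union_add_card_inter _ _
      have := hmax (insert c C) ⟨Finset.insert_subset hc hC.1, by
        rw [hb, Finset.card_insert_of_notMem hcC]
        push_cast
        have := hC.2
        nlinarith⟩
      rw [Finset.card_insert_of_notMem hcC] at this
      omega
  have hsum : ∑ c ∈ I, (trans' A c ∩ U).card ≤ U.card * A.card := by
    have : ∀ c, (trans' A c ∩ U).card = ∑ u ∈ U, if u ∈ trans' A c then 1 else 0 := by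
      intro c
      rw [Finset.inter_comm, ← Finset.filter_mem_eq_inter, Finset.card_filter]
    simp_rw [this]
    rw [Finset.sum_comm, ← smul_eq_mul]
    apply Finset.sum_le_card_nsmul
    intro u _
    rw [← Finset.card_filter]
    apply Finset.card_le_card_of_injOn (fun c => u * c⁻¹)
    · intro c hc
      simp only [Finset.coe_filter, Set.mem_ofPred_eq] at hc
      exact mem_trans'.1 hc.2
    · intro a _ b _ h
      simpa using h
  have h1 : (I.card : ℝ) * (η * A.card) ≤ ∑ c ∈ I, ((trans' A c ∩ U).card : ℝ) := by
    rw [← nsmul_eq_mul]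
    exact Finset.card_nsmul_le_sum _ _ _ key
  have h2 : ∑ c ∈ I, ((trans' A c ∩ U).card : ℝ) ≤ U.card * A.card := by exact_mod_cast hsum
  have h3 : (I.card * η : ℝ) * A.card ≤ U.card * A.card := by nlinarith
  have h4 := le_of_mul_le_mul_right h3 hApos
  nlinarith

/-- points `t` outside `A` moved into `A` by `k` -/
lemma card_boundary (A K : Finset Γ) (δ : ℝ) (hA : memApproxInv K δ A) (k : Γ) (hk : k ∈ K) :
    (((A.image (fun a => k⁻¹ * a)) \ A).card : ℝ) ≤ δ * A.card := by
  have h1 : ((A.image (fun a => k⁻¹ * a)) \ A).card = (A \ (A.image (fun a => k⁻¹ * a))).card := by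
    apply Finset.card_sdiff_comm
    exact Finset.card_image_of_injective _ (mul_right_injective _)
  have h2 : (A \ (A.image (fun a => k⁻¹ * a))).card ≤
      (A.filter fun t => ¬ ∀ k ∈ K, k * t ∈ A).card := by
    apply Finset.card_le_card
    intro t ht
    simp only [Finset.mem_sdiff, Finset.mem_image, Finset.mem_filter] at ht ⊢
    refine ⟨ht.1, fun h => ht.2 ⟨k * t, h k hk, by simp⟩⟩
  have h3 : (A.filter fun t => ∀ k ∈ K, k * t ∈ A).card +
      (A.filter fun t => ¬ ∀ k ∈ K, k * t ∈ A).card = A.card :=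
    Finset.card_filter_add_card_filter_not _
  have h4 := hA.2
  have h2' : ((A \ (A.image (fun a => k⁻¹ * a))).card : ℝ) ≤
      (A.filter fun t => ¬ ∀ k ∈ K, k * t ∈ A).card := by exact_mod_cast h2
  have h3' : ((A.filter fun t => ∀ k ∈ K, k * t ∈ A).card : ℝ) +
      (A.filter fun t => ¬ ∀ k ∈ K, k * t ∈ A).card = A.card := by exact_mod_cast h3
  rw [h1]
  linarith

lemma remainder_inv (A F C K : Finset Γ) (δ₁ δ₂ δ κ η : ℝ) (hA : memApproxInv K δ₂ A)
    (hF : memApproxInv K δ₁ F) (hη1 : η ≤ 1 / 2) (hδ2 : 0 ≤ δ₂)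
    (hδ : 0 < δ) (hd1 : δ₁ ≤ δ * κ / 2) (hd2 : 2 * K.card * δ₂ ≤ δ * κ / 2)
    (hCF : C.biUnion (trans' A) ⊆ F)
    (hC : (1 - η) * (C.card * A.card : ℝ) ≤ ((C.biUnion (trans' A)).card : ℝ))
    (hR : κ * F.card < ((F \ C.biUnion (trans' A)).card : ℝ)) (hκ : 0 < κ) :
    memApproxInv K δ (F \ C.biUnion (trans' A)) := by
  classical
  set U := C.biUnion (trans' A) with hU
  set R := F \ U with hRdef
  have hF0 : (0 : ℝ) ≤ F.card := by positivity
  refine ⟨?_, ?_⟩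
  · rw [← Finset.card_pos]
    have : (0 : ℝ) < R.card := lt_of_le_of_lt (by positivity) hR
    exact_mod_cast this
  have hsub : (R.filter fun t => ¬ ∀ k ∈ K, k * t ∈ R) ⊆
      (F.filter fun t => ¬ ∀ k ∈ K, k * t ∈ F) ∪
      (C ×ˢ K).biUnion (fun p => trans' ((A.image (fun a => p.2⁻¹ * a)) \ A) p.1) := by
    intro t ht
    simp only [Finset.mem_filter] at ht
    obtain ⟨htR, htk⟩ := ht
    push Not at htk
    obtain ⟨k, hk, hkt⟩ := htk
    have htF : t ∈ F := (Finset.mem_sdiff.1 htR).1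
    have htU : t ∉ U := (Finset.mem_sdiff.1 htR).2
    by_cases hkF : k * t ∈ F
    · have hkU : k * t ∈ U := by
        by_contra h
        exact hkt (Finset.mem_sdiff.2 ⟨hkF, h⟩)
      obtain ⟨c, hc, hktc⟩ := Finset.mem_biUnion.1 hkU
      refine Finset.mem_union_right _ (Finset.mem_biUnion.2 ⟨(c, k), ?_, ?_⟩)
      · exact Finset.mem_product.2 ⟨hc, hk⟩
      · rw [mem_trans', Finset.mem_sdiff]
        refine ⟨Finset.mem_image.2 ⟨_, mem_trans'.1 hktc, by group⟩, fun h => htU ?_⟩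
        exact Finset.mem_biUnion.2 ⟨c, hc, mem_trans'.2 h⟩
    · refine Finset.mem_union_left _ (Finset.mem_filter.2 ⟨htF, fun h => hkF (h k hk)⟩)
  have hc1 := (Finset.card_le_card hsub).trans (Finset.card_union_le _ _)
  have hc2 : ((C ×ˢ K).biUnion
      (fun p => trans' ((A.image (fun a => p.2⁻¹ * a)) \ A) p.1)).card ≤
      ∑ p ∈ C ×ˢ K, ((A.image (fun a => p.2⁻¹ * a)) \ A).card := by
    refine Finset.card_biUnion_le.trans (le_of_eq ?_)
    exact Finset.sum_congr rfl (fun p _ => card_trans' _ _)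
  have hc3 : ∑ p ∈ C ×ˢ K, (((A.image (fun a => p.2⁻¹ * a)) \ A).card : ℝ) ≤
      (C.card * K.card : ℝ) * (δ₂ * A.card) := by
    have := Finset.sum_le_card_nsmul (C ×ˢ K)
      (fun p => (((A.image (fun a => p.2⁻¹ * a)) \ A).card : ℝ)) (δ₂ * A.card)
      (fun p hp => card_boundary A K δ₂ hA p.2 (Finset.mem_product.1 hp).2)
    rw [nsmul_eq_mul, Finset.card_product] at this
    push_cast at this
    exact this
  have hc2' : (((C ×ˢ K).biUnion
      (fun p => trans' ((A.image (fun a => p.2⁻¹ * a)) \ A) p.1)).card : ℝ) ≤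
      ∑ p ∈ C ×ˢ K, (((A.image (fun a => p.2⁻¹ * a)) \ A).card : ℝ) := by exact_mod_cast hc2
  have hc1' : ((R.filter fun t => ¬ ∀ k ∈ K, k * t ∈ R).card : ℝ) ≤
      (F.filter fun t => ¬ ∀ k ∈ K, k * t ∈ F).card + ((C ×ˢ K).biUnion
      (fun p => trans' ((A.image (fun a => p.2⁻¹ * a)) \ A) p.1)).card := by exact_mod_cast hc1
  have hFb : ((F.filter fun t => ∀ k ∈ K, k * t ∈ F).card : ℝ) +
      (F.filter fun t => ¬ ∀ k ∈ K, k * t ∈ F).card = F.card := by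
    exact_mod_cast Finset.card_filter_add_card_filter_not (s := F) (fun t => ∀ k ∈ K, k * t ∈ F)
  have hRb : ((R.filter fun t => ∀ k ∈ K, k * t ∈ R).card : ℝ) +
      (R.filter fun t => ¬ ∀ k ∈ K, k * t ∈ R).card = R.card := by
    exact_mod_cast Finset.card_filter_add_card_filter_not (s := R) (fun t => ∀ k ∈ K, k * t ∈ R)
  have hF2 := hF.2
  have hUF : (U.card : ℝ) ≤ F.card := by exact_mod_cast Finset.card_le_card hCF
  have hCA : (C.card * A.card : ℝ) ≤ 2 * F.card := by
    have : (0 : ℝ) ≤ C.card * A.card := by positivity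
    nlinarith
  have hc4 : (C.card * K.card : ℝ) * (δ₂ * A.card) ≤ (2 * K.card * δ₂) * F.card := by
    have : (0 : ℝ) ≤ K.card * δ₂ := by positivity
    nlinarith
  have hc5 : (2 * K.card * δ₂) * F.card ≤ δ * κ / 2 * F.card :=
    mul_le_mul_of_nonneg_right hd2 hF0
  have hc6 : δ₁ * F.card ≤ δ * κ / 2 * F.card := mul_le_mul_of_nonneg_right hd1 hF0
  have hc7 : δ * (κ * F.card) ≤ δ * R.card := mul_le_mul_of_nonneg_left hR.le hδ.le
  linarith

lemma sub_biUnion (H : Finset Γ → ℝ) (h0 : H ∅ ≤ 0) (hsub : ∀ S T, H (S ∪ T) ≤ H S + H T)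
    (b : ℝ) (C : Finset Γ) (f : Γ → Finset Γ) (hb : ∀ c ∈ C, H (f c) ≤ b) :
    H (C.biUnion f) ≤ C.card * b := by
  classical
  induction C using Finset.induction_on with
  | empty => simpa using h0
  | insert c C hc ih =>
    rw [Finset.biUnion_insert, Finset.card_insert_of_notMem hc]
    have h1 := ih (fun x hx => hb x (Finset.mem_insert_of_mem hx))
    have h2 := hb c (Finset.mem_insert_self _ _)
    have h3 := hsub (f c) (C.biUnion f)
    push_cast
    linarith

lemma sub_points (H : Finset Γ → ℝ) (h0 : H ∅ ≤ 0) (hsub : ∀ S T, H (S ∪ T) ≤ H S + H T)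
    (L : ℝ) (hL : ∀ t, H {t} ≤ L) (F : Finset Γ) : H F ≤ F.card * L := by
  have := sub_biUnion H h0 hsub L F (fun t => {t}) (fun c _ => hL c)
  simpa using this

/-- Ornstein–Weiss type estimate. -/
lemma ornstein_weiss
    (hamen : ∀ K : Finset Γ, K.Nonempty → ∀ δ : ℝ, 0 < δ → ∃ F : Finset Γ, memApproxInv K δ F)
    (K : Finset Γ) (δ : ℝ) (hδ : 0 < δ) (E : Finset Γ → Finset Γ)
    (M L η : ℝ) (hM : 0 ≤ M) (hL0 : 0 ≤ L) (hη : 0 < η) (hη1 : η ≤ 1 / 2) (n : ℕ) :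
    ∃ K' : Finset Γ, ∃ δ' : ℝ, K'.Nonempty ∧ 0 < δ' ∧ ∀ F, memApproxInv K' δ' F →
      ∀ H : Finset Γ → ℝ, H ∅ ≤ 0 → (∀ S T, H (S ∪ T) ≤ H S + H T) → (∀ t, H {t} ≤ L) →
      (∀ A c, memApproxInv K δ A → trans' (E A) c ⊆ F → H (trans' A c) ≤ M * A.card) →
      H F ≤ (M / (1 - η) + (1 - η / 2) ^ n * L) * F.card := by
  classical
  have hη' : 0 < 1 - η := by linarith
  induction n with
  | zero =>
    refine ⟨{1}, 1, by simp, one_pos, ?_⟩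
    intro F _ H h0 hsub hL _
    have := sub_points H h0 hsub L hL F
    have h2 : 0 ≤ M / (1 - η) * F.card := by positivity
    simp only [pow_zero, one_mul]
    nlinarith
  | succ n ih =>
    obtain ⟨K', δ', hK', hδ', hP⟩ := ih
    set κ : ℝ := (1 - η / 2) ^ (n + 1) with hκdef
    have hκ : 0 < κ := by apply pow_pos; linarith
    have hK'c : (0 : ℝ) < K'.card := by exact_mod_cast hK'.card_pos
    set δ₂ : ℝ := δ' * κ / (4 * K'.card) with hδ₂
    have hδ₂pos : 0 < δ₂ := by positivity
    obtain ⟨A, hA⟩ := hamen (K ∪ K') (hK'.mono Finset.subset_union_right) (min δ δ₂)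
      (lt_min hδ hδ₂pos)
    have hA1 : memApproxInv K δ A := hA.mono' Finset.subset_union_left (min_le_left _ _)
    have hA2 : memApproxInv K' δ₂ A := hA.mono' Finset.subset_union_right (min_le_right _ _)
    refine ⟨K' ∪ (A ∪ E A), min (δ' * κ / 2) (1 / 2), hK'.mono Finset.subset_union_left,
      by positivity, ?_⟩
    intro F hF H h0 hsub hL hT
    have hF1 : memApproxInv K' (δ' * κ / 2) F :=
      hF.mono' Finset.subset_union_left (min_le_left _ _)
    have hF2 : memApproxInv (A ∪ E A) (1 / 2) F :=
      hF.mono' Finset.subset_union_right (min_le_right _ _)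
    set I := F.filter fun t => ∀ k ∈ A ∪ E A, k * t ∈ F with hI
    have hIsub : ∀ c ∈ I, trans' A c ⊆ F ∧ trans' (E A) c ⊆ F := by
      intro c hc
      have hc' := (Finset.mem_filter.1 hc).2
      constructor
      · intro t ht
        have := hc' _ (Finset.mem_union_left _ (mem_trans'.1 ht))
        simpa using this
      · intro t ht
        have := hc' _ (Finset.mem_union_right _ (mem_trans'.1 ht))
        simpa using this
    obtain ⟨C, hCI, hC1, hC2⟩ := greedy A F I hA1.1 η hη hη1 (fun c hc => (hIsub c hc).1)
      (by have := hF2.2; linarith)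
    set U := C.biUnion (trans' A) with hU
    have hUF : U ⊆ F := Finset.biUnion_subset.2 (fun c hc => (hIsub c (hCI hc)).1)
    have hHU : H U ≤ C.card * (M * A.card) :=
      sub_biUnion H h0 hsub _ C _ (fun c hc => hT A c hA1 (hIsub c (hCI hc)).2)
    have hHU' : H U ≤ M / (1 - η) * U.card := by
      refine hHU.trans ?_
      rw [div_mul_eq_mul_div, le_div_iff₀ hη']
      nlinarith
    have hHF : H F ≤ H U + H (F \ U) := by
      have := hsub U (F \ U)
      rwa [Finset.union_sdiff_of_subset hUF] at this
    have hcard : ((F \ U).card : ℝ) + U.card = F.card := by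
      exact_mod_cast Finset.card_sdiff_add_card_eq_card hUF
    have hMη : 0 ≤ M / (1 - η) := by positivity
    by_cases hR : κ * F.card < ((F \ U).card : ℝ)
    · have hRinv := remainder_inv A F C K' (δ' * κ / 2) δ₂ δ' κ η hA2 hF1 hη1 hδ₂pos.le hδ' le_rfl
        (by rw [hδ₂]; field_simp; norm_num) hUF hC1 hR hκ
      have hHR := hP _ hRinv H h0 hsub hL
        (fun A c hA hc => hT A c hA (hc.trans Finset.sdiff_subset))
      have hle : ((F \ U).card : ℝ) ≤ (1 - η / 2) * F.card := by linarith
      have hpow : 0 ≤ (1 - η / 2) ^ n * L := mul_nonneg (pow_nonneg (by linarith) _) hL0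
      have h5 := mul_le_mul_of_nonneg_left hle hpow
      have h6 : (1 - η / 2) ^ n * L * ((1 - η / 2) * F.card) = κ * L * F.card := by
        rw [hκdef, pow_succ]; ring
      calc H F ≤ M / (1 - η) * U.card + (M / (1 - η) + (1 - η / 2) ^ n * L) * (F \ U).card := by
            linarith
        _ = M / (1 - η) * ((F \ U).card + U.card) + (1 - η / 2) ^ n * L * (F \ U).card := by ring
        _ ≤ M / (1 - η) * F.card + κ * L * F.card := by rw [hcard]; linarith
        _ = _ := by ring
    · push Not at hR
      have hHR := sub_points H h0 hsub L hL (F \ U)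
      have h5 := mul_le_mul_of_nonneg_right hR hL0
      have h6 : M / (1 - η) * U.card ≤ M / (1 - η) * F.card :=
        mul_le_mul_of_nonneg_left (by linarith [(Nat.cast_nonneg (F \ U).card : (0:ℝ) ≤ _)]) hMη
      calc H F ≤ M / (1 - η) * F.card + κ * F.card * L := by linarith
        _ = _ := by ring

/-! ### Counting -/

/-- `Z` can be coloured by `n` colours such that points of the same colour are not separated. -/
def cov {d : ℕ} (Z : Set (Γ → Fin d → AddCircle (1 : ℝ))) (e : ℝ) (T : Finset Γ) (n : ℕ) : Prop :=
  ∃ g : (Γ → Fin d → AddCircle (1 : ℝ)) → Fin n,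
    ∀ x ∈ Z, ∀ y ∈ Z, g x = g y → ¬ thetaInfSep e T x y

variable {d : ℕ} {Z : Set (Γ → Fin d → AddCircle (1 : ℝ))} {e : ℝ}

lemma cov_of_fintype {α : Type*} [Fintype α] (T : Finset Γ)
    (g : (Γ → Fin d → AddCircle (1 : ℝ)) → α)
    (hg : ∀ x ∈ Z, ∀ y ∈ Z, g x = g y → ¬ thetaInfSep e T x y) :
    cov Z e T (Fintype.card α) :=
  ⟨fun x => Fintype.equivFin α (g x), fun x hx y hy h =>
    hg x hx y hy ((Fintype.equivFin α).injective h)⟩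

lemma cov_pos {T : Finset Γ} {n : ℕ} (h : cov Z e T n) : 0 < n := by
  obtain ⟨g, _⟩ := h
  exact (g 0).pos

lemma cov_union {S T : Finset Γ} {m n : ℕ} (h : cov Z e S m) (h' : cov Z e T n) :
    cov Z e (S ∪ T) (m * n) := by
  obtain ⟨g, hg⟩ := h
  obtain ⟨g', hg'⟩ := h'
  have := cov_of_fintype (Z := Z) (e := e) (S ∪ T) (fun x => (g x, g' x)) (by
    rintro x hx y hy hxy ⟨s, hs, j, hj⟩
    simp only [Prod.mk.injEq] at hxy
    rcases Finset.mem_union.1 hs with hs | hs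
    · exact hg x hx y hy hxy.1 ⟨s, hs, j, hj⟩
    · exact hg' x hx y hy hxy.2 ⟨s, hs, j, hj⟩)
  simpa using this

lemma cov_empty : cov Z e (∅ : Finset Γ) 1 :=
  ⟨fun _ => 0, by rintro x _ y _ _ ⟨s, hs, _⟩; simp at hs⟩

lemma card_le_of_cov {T : Finset Γ} {n : ℕ} (h : cov Z e T n)
    (W : Finset (Γ → Fin d → AddCircle (1 : ℝ))) (hW : ↑W ⊆ Z)
    (hs : ∀ x ∈ W, ∀ y ∈ W, x ≠ y → thetaInfSep e T x y) : W.card ≤ n := by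
  obtain ⟨g, hg⟩ := h
  have : W.card ≤ (Finset.univ : Finset (Fin n)).card := by
    apply Finset.card_le_card_of_injOn g (by simp)
    intro x hx y hy hxy
    by_contra hne
    exact hg x (hW hx) y (hW hy) hxy (hs x hx y hy hne)
  simpa using this

lemma sep_bdd {T : Finset Γ} {n : ℕ} (h : cov Z e T n) :
    n ∈ upperBounds {n : ℕ | ∃ W : Finset (Γ → Fin d → AddCircle (1 : ℝ)), ↑W ⊆ Z ∧
      (∀ x ∈ W, ∀ y ∈ W, x ≠ y → thetaInfSep e T x y) ∧ W.card = n} := by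
  rintro m ⟨W, hW, hs, rfl⟩
  exact card_le_of_cov h W hW hs

lemma sep_nonempty (T : Finset Γ) :
    {n : ℕ | ∃ W : Finset (Γ → Fin d → AddCircle (1 : ℝ)), ↑W ⊆ Z ∧
      (∀ x ∈ W, ∀ y ∈ W, x ≠ y → thetaInfSep e T x y) ∧ W.card = n}.Nonempty :=
  ⟨0, ∅, by simp, by simp, by simp⟩

lemma sepCount_le_of_cov {T : Finset Γ} {n : ℕ} (h : cov Z e T n) :
    sepCount Z (thetaInfSep e T) ≤ n :=
  csSup_le (sep_nonempty T) (sep_bdd h)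

lemma point_cov (d : ℕ) (e : ℝ) (he : 0 < e) : ∃ M : ℕ, 0 < M ∧
    ∀ (Z : Set (Γ → Fin d → AddCircle (1 : ℝ))) (t : Γ), cov Z e {t} M := by
  obtain ⟨N, -, hN, hcov⟩ := finite_cover_balls_of_compact
    (isCompact_univ : IsCompact (Set.univ : Set (Fin d → AddCircle (1 : ℝ)))) (half_pos he)
  have : ∀ z : Fin d → AddCircle (1 : ℝ), ∃ w : N, dist z w < e / 2 := by
    intro z
    have := hcov (Set.mem_univ z)
    simp only [Set.mem_iUnion, Metric.mem_ball] at this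
    obtain ⟨w, hw, h⟩ := this
    exact ⟨⟨w, hw⟩, h⟩
  choose p hp using this
  let _ := hN.fintype
  have hc : ∀ (Z : Set (Γ → Fin d → AddCircle (1 : ℝ))) (t : Γ),
      cov Z e {t} (Fintype.card N) := by
    intro Z t
    apply cov_of_fintype {t} (fun x => p (x t))
    rintro x _ y _ hxy ⟨s, hs, j, hj⟩
    rw [Finset.mem_singleton] at hs
    subst hs
    have h1 := hp (x s)
    have h2 := hp (y s)
    rw [show p (x s) = p (y s) from hxy] at h1
    have h3 : dist (x s) (y s) < e := by
      have := dist_triangle_right (x s) (y s) (p (y s))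
      linarith
    exact absurd (dist_le_pi_dist (x s) (y s) j) (by linarith)
  exact ⟨_, cov_pos (hc ∅ 1), hc⟩

lemma exists_cov {M : ℕ} (hM : ∀ t : Γ, cov Z e {t} M) (T : Finset Γ) :
    cov Z e T (M ^ T.card) := by
  induction T using Finset.induction_on with
  | empty => simpa using cov_empty
  | insert a T ha ih =>
    rw [Finset.card_insert_of_notMem ha, pow_succ, mul_comm, Finset.insert_eq]
    exact cov_union (hM a) ih

/-- minimal number of colours -/
noncomputable def minCov (Z : Set (Γ → Fin d → AddCircle (1 : ℝ))) (e : ℝ) (T : Finset Γ) : ℕ :=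
  sInf {n | cov Z e T n}

lemma minCov_spec {M : ℕ} (hM : ∀ t : Γ, cov Z e {t} M) (T : Finset Γ) :
    cov Z e T (minCov Z e T) :=
  Nat.sInf_mem (s := {n | cov Z e T n}) ⟨_, exists_cov hM T⟩

lemma minCov_le {T : Finset Γ} {n : ℕ} (h : cov Z e T n) : minCov Z e T ≤ n := Nat.sInf_le h

lemma log_minCov_le {M : ℕ} (hM : ∀ t : Γ, cov Z e {t} M) {T : Finset Γ} {n : ℕ}
    (h : cov Z e T n) : Real.log (minCov Z e T) ≤ Real.log n := by
  apply Real.log_le_log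
  · exact_mod_cast cov_pos (minCov_spec hM T)
  · exact_mod_cast minCov_le h

/-- a maximal separated set yields a colouring -/
lemma cov_sepCount (h0 : Z.Nonempty) {M : ℕ} (hM : ∀ t : Γ, cov Z e {t} M) (T : Finset Γ)
    (he : 0 ≤ e) :
    ∃ W : Finset (Γ → Fin d → AddCircle (1 : ℝ)), W.card = sepCount Z (thetaInfSep e T) ∧
      W.Nonempty ∧ ∀ x ∈ Z, ∃ w ∈ W, ¬ thetaInfSep e T x w := by
  classical
  have hbdd := sep_bdd (exists_cov hM T)
  obtain ⟨W, hW, hs, hc⟩ := Nat.sSup_mem (sep_nonempty (Z := Z) (e := e) T) ⟨_, hbdd⟩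
  have key : ∀ x ∈ Z, ∃ w ∈ W, ¬ thetaInfSep e T x w := by
    intro x hx
    by_contra hcon
    push Not at hcon
    have hxW : x ∉ W := by
      intro hxW
      obtain ⟨s, _, j, hj⟩ := hcon x hxW
      rw [dist_self] at hj
      linarith
    have hmem : (insert x W).card ≤ sepCount Z (thetaInfSep e T) := by
      apply le_csSup ⟨_, hbdd⟩
      refine ⟨insert x W, ?_, ?_, rfl⟩
      · rw [Finset.coe_insert]
        exact Set.insert_subset hx hW
      · intro a ha b hb hab
        rcases Finset.mem_insert.1 ha with hax | haW
        · rcases Finset.mem_insert.1 hb with hbx | hbW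
          · exact absurd (hax.trans hbx.symm) hab
          · rw [hax]; exact hcon b hbW
        · rcases Finset.mem_insert.1 hb with hbx | hbW
          · obtain ⟨s, hs, j, hj⟩ := hcon a haW
            exact ⟨s, hs, j, by rwa [hbx, dist_comm]⟩
          · exact hs a haW b hbW hab
    rw [Finset.card_insert_of_notMem hxW] at hmem
    have : W.card = sepCount Z (thetaInfSep e T) := hc
    omega
  refine ⟨W, hc, ?_, key⟩
  obtain ⟨x, hx⟩ := h0
  obtain ⟨w, hw, _⟩ := key x hx
  exact ⟨w, hw⟩

/-! ### Compactness -/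

lemma rowEval_continuous (f : Γ → Fin d → ℤ) (hf : (Function.support f).Finite) (t : Γ) :
    Continuous (fun x : Γ → Fin d → AddCircle (1 : ℝ) => rowEval f x t) := by
  have : ∀ x : Γ → Fin d → AddCircle (1 : ℝ), rowEval f x t =
      ∑ s ∈ hf.toFinset, ∑ j : Fin d, f s j • x (s⁻¹ * t) j := by
    intro x
    unfold rowEval
    apply finsum_eq_sum_of_support_subset
    intro s hs
    simp only [Set.Finite.coe_toFinset, Function.mem_support] at hs ⊢
    intro h
    apply hs
    simp [h]
  simp_rw [this]
  fun_prop

lemma XJF_closed (J : Set (Γ → Fin d → ℤ)) (hJ : ∀ f ∈ J, (Function.support f).Finite)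
    (F : Finset Γ) : IsClosed (XJF J F) := by
  have : XJF J F = ⋂ f ∈ J, ⋂ t ∈ F, {x | rowEval f x t = 0} := by
    ext x; simp [XJF]
  rw [this]
  refine isClosed_biInter fun f hf => isClosed_biInter fun t _ => ?_
  exact isClosed_eq (rowEval_continuous f (hJ f hf) t) continuous_const

lemma compactness (J : Set (Γ → Fin d → ℤ)) (hJ : ∀ f ∈ J, (Function.support f).Finite)
    (ε : ℝ) (hε : 0 < ε) (A : Finset Γ) :
    ∃ E : Finset Γ, ∀ y ∈ XJF J E, ∃ z ∈ XJ J, ∀ s ∈ A, ∀ j, dist (y s j) (z s j) ≤ ε := by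
  set V : Set (Γ → Fin d → AddCircle (1 : ℝ)) :=
    ⋃ z ∈ XJ J, ⋂ s ∈ A, ⋂ j, {y | dist (y s j) (z s j) < ε} with hV
  have hVo : IsOpen V := by
    refine isOpen_biUnion fun z _ => isOpen_biInter_finset fun s _ => isOpen_iInter_of_finite fun j => ?_
    exact isOpen_lt (by fun_prop) continuous_const
  have hint : ⋂ E, XJF J E ⊆ V := by
    intro x hx
    simp only [Set.mem_iInter] at hx
    have hxJ : x ∈ XJ J := fun f hf t => hx {t} f hf t (by simp)
    simp only [hV, Set.mem_iUnion, Set.mem_iInter, Set.mem_ofPred_eq]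
    exact ⟨x, hxJ, fun s _ j => by simpa using hε⟩
  have hdir : Directed (· ⊇ ·) (fun E => XJF J E) := by
    intro E E'
    exact ⟨E ∪ E', fun x hx f hf t ht => hx f hf t (Finset.mem_union_left _ ht),
      fun x hx f hf t ht => hx f hf t (Finset.mem_union_right _ ht)⟩
  obtain ⟨E, hE⟩ := exists_subset_nhds_of_isCompact' hdir
    (fun E => (XJF_closed J hJ E).isCompact) (fun E => XJF_closed J hJ E)
    (fun x hx => hVo.mem_nhds (hint hx))
  refine ⟨E, fun y hy => ?_⟩
  have := hE hy
  simp only [hV, Set.mem_iUnion, Set.mem_iInter, Set.mem_ofPred_eq] at this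
  obtain ⟨z, hz, h⟩ := this
  exact ⟨z, hz, fun s hs j => (h s hs j).le⟩

lemma rowEval_translate (f : Γ → Fin d → ℤ) (x : Γ → Fin d → AddCircle (1 : ℝ)) (c t : Γ) :
    rowEval f (fun s => x (s * c)) t = rowEval f x (t * c) := by
  simp [rowEval, mul_assoc]

lemma zero_mem_XJ (J : Set (Γ → Fin d → ℤ)) : (0 : Γ → Fin d → AddCircle (1 : ℝ)) ∈ XJ J := by
  intro f _ t
  simp [rowEval]

lemma tile_cov (J : Set (Γ → Fin d → ℤ)) (ε : ℝ) (hε : 0 < ε) (A E F : Finset Γ)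
    (hE : ∀ y ∈ XJF J E, ∃ z ∈ XJ J, ∀ s ∈ A, ∀ j, dist (y s j) (z s j) ≤ ε)
    {M : ℕ} (hM : ∀ t : Γ, cov (XJ J) ε {t} M) (c : Γ) (hc : trans' E c ⊆ F) :
    cov (XJF J F) (4 * ε) (trans' A c) (sepCount (XJ J) (thetaInfSep ε A)) := by
  classical
  obtain ⟨W, hWc, ⟨w0, hw0⟩, hW⟩ := cov_sepCount ⟨0, zero_mem_XJ J⟩ hM A hε.le
  have key : ∀ x : Γ → Fin d → AddCircle (1 : ℝ), ∃ w : W, x ∈ XJF J F →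
      ∀ s ∈ A, ∀ j, dist (x (s * c) j) (w.1 s j) ≤ 2 * ε := by
    intro x
    by_cases hx : x ∈ XJF J F
    · obtain ⟨z, hz, hyz⟩ := hE (fun s => x (s * c)) (by
        intro f hf t ht
        rw [rowEval_translate]
        exact hx f hf _ (hc (mem_trans'.2 (by simpa using ht))))
      obtain ⟨w, hw, hzw⟩ := hW z hz
      refine ⟨⟨w, hw⟩, fun _ s hs j => ?_⟩
      have h1 := hyz s hs j
      have h2 : dist (z s j) (w s j) ≤ ε := by
        by_contra h
        exact hzw ⟨s, hs, j, not_le.1 h⟩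
      have := dist_triangle (x (s * c) j) (z s j) (w s j)
      linarith
    · exact ⟨⟨w0, hw0⟩, fun h => absurd h hx⟩
  choose g hg using key
  have := cov_of_fintype (Z := XJF J F) (e := 4 * ε) (trans' A c) g (by
    rintro x hx y hy hxy ⟨s, hs, j, hj⟩
    have h1 := hg x hx _ (mem_trans'.1 hs) j
    have h2 := hg y hy _ (mem_trans'.1 hs) j
    rw [← hxy] at h2
    simp only [inv_mul_cancel_right] at h1 h2
    have := dist_triangle_right (x s j) (y s j) ((g x).1 (s * c⁻¹) j)
    linarith)
  rwa [Fintype.card_coe, hWc] at this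

lemma psi_le {M : ℕ} (hMpos : 0 < M) (hM : ∀ t : Γ, cov Z e {t} M) (T : Finset Γ) :
    Real.log (sepCount Z (thetaInfSep e T)) / (T.card : ℝ) ≤ Real.log M := by
  have hlog : 0 ≤ Real.log M := Real.log_nonneg (by exact_mod_cast hMpos)
  apply div_le_of_le_mul₀ (by positivity) hlog
  rcases Nat.eq_zero_or_pos (sepCount Z (thetaInfSep e T)) with h | h
  · rw [h]; simp; positivity
  · have h1 := sepCount_le_of_cov (exists_cov hM T)
    have h2 : (sepCount Z (thetaInfSep e T) : ℝ) ≤ (M : ℝ) ^ T.card := by exact_mod_cast h1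
    have h3 := Real.log_le_log (by exact_mod_cast h) h2
    rw [Real.log_pow] at h3
    linarith

lemma psi_nonneg (T : Finset Γ) :
    0 ≤ Real.log (sepCount Z (thetaInfSep e T)) / (T.card : ℝ) :=
  div_nonneg (Real.log_natCast_nonneg _) (by positivity)

lemma limsupFolner_bddBelow (ψ : Finset Γ → ℝ) (h : ∀ F, 0 ≤ ψ F) :
    BddBelow (Set.range fun p : {p : Finset Γ × ℝ // p.1.Nonempty ∧ 0 < p.2} =>
      ⨆ F : {F : Finset Γ // memApproxInv p.1.1 p.1.2 F}, ψ F.1) := by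
  refine ⟨0, ?_⟩
  rintro _ ⟨p, rfl⟩
  exact Real.iSup_nonneg fun F => h F.1

lemma limsupFolner_le (ψ : Finset Γ → ℝ) (h : ∀ F, 0 ≤ ψ F) (K : Finset Γ) (δ b : ℝ)
    (hK : K.Nonempty) (hδ : 0 < δ) (hne : ∃ F, memApproxInv K δ F)
    (hb : ∀ F, memApproxInv K δ F → ψ F ≤ b) : limsupFolner ψ ≤ b := by
  refine (ciInf_le (limsupFolner_bddBelow ψ h) ⟨(K, δ), hK, hδ⟩).trans ?_
  obtain ⟨F, hF⟩ := hne
  have : Nonempty {F : Finset Γ // memApproxInv K δ F} := ⟨⟨F, hF⟩⟩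
  exact ciSup_le fun F => hb F.1 F.2

lemma limsupFolner_mono (ψ φ : Finset Γ → ℝ) (h : ∀ F, 0 ≤ ψ F) (b : ℝ) (hb : ∀ F, φ F ≤ b)
    (hle : ∀ F, ψ F ≤ φ F) : limsupFolner ψ ≤ limsupFolner φ := by
  refine ciInf_mono (limsupFolner_bddBelow ψ h) fun p => ?_
  refine ciSup_mono ⟨b, ?_⟩ fun F => hle F.1
  rintro _ ⟨F, rfl⟩
  exact hb F.1

end Helpers

/-- **Lemma 4.4: comparison of separation numbers of exact and approximate solutions.**
For a countable discrete amenable group `Γ`, a set `J ⊆ (ℤΓ)^{1×d}` and `ε > 0`: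
`limsup_F log N_{4ε}(X_{J,F}, ϑ_{F,∞})/|F| ≤ limsup_F log N_ε(X_J, ϑ_{F,∞})/|F|
  ≤ limsup_F log N_ε(X_{J,F}, ϑ_{F,∞})/|F|`. -/
theorem sepCount_approximate_solutions {Γ : Type*} [Group Γ] [Countable Γ] [DecidableEq Γ]
    (hamen : ∀ K : Finset Γ, K.Nonempty → ∀ δ : ℝ, 0 < δ → ∃ F : Finset Γ, memApproxInv K δ F)
    (d : ℕ) (hd : 1 ≤ d)
    (J : Set (Γ → Fin d → ℤ)) (hJ : ∀ f ∈ J, (Function.support f).Finite)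
    (ε : ℝ) (hε : 0 < ε) :
    limsupFolner (fun F =>
        Real.log (sepCount (XJF J F) (thetaInfSep (4 * ε) F)) / (F.card : ℝ)) ≤
      limsupFolner (fun F =>
        Real.log (sepCount (XJ J) (thetaInfSep ε F)) / (F.card : ℝ)) ∧
    limsupFolner (fun F =>
        Real.log (sepCount (XJ J) (thetaInfSep ε F)) / (F.card : ℝ)) ≤
      limsupFolner (fun F =>
        Real.log (sepCount (XJF J F) (thetaInfSep ε F)) / (F.card : ℝ)) := by
  obtain ⟨M, hMpos, hM⟩ := point_cov (Γ := Γ) d ε hε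
  obtain ⟨L, hLpos, hL⟩ := point_cov (Γ := Γ) d (4 * ε) (by positivity)
  have hlogL : 0 ≤ Real.log L := Real.log_natCast_nonneg _
  have : Nonempty {p : Finset Γ × ℝ // p.1.Nonempty ∧ 0 < p.2} :=
    ⟨⟨({1}, 1), by simp, by norm_num⟩⟩
  constructor
  · refine le_ciInf ?_
    rintro ⟨⟨K, δ⟩, hK, hδ⟩
    dsimp only at hK hδ ⊢
    set B := ⨆ F : {F : Finset Γ // memApproxInv K δ F},
      Real.log (sepCount (XJ J) (thetaInfSep ε F.1)) / (F.1.card : ℝ) with hB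
    have hB0 : 0 ≤ B := Real.iSup_nonneg fun F => psi_nonneg _
    have hBle : ∀ A, memApproxInv K δ A →
        Real.log (sepCount (XJ J) (thetaInfSep ε A)) ≤ B * A.card := by
      intro A hA
      have h1 : Real.log (sepCount (XJ J) (thetaInfSep ε A)) / (A.card : ℝ) ≤ B := by
        refine le_ciSup (f := fun F : {F : Finset Γ // memApproxInv K δ F} =>
          Real.log (sepCount (XJ J) (thetaInfSep ε F.1)) / (F.1.card : ℝ)) ?_ ⟨A, hA⟩
        refine ⟨Real.log M, ?_⟩
        rintro _ ⟨F, rfl⟩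
        exact psi_le hMpos (hM _) _
      have hApos : (0 : ℝ) < A.card := by exact_mod_cast hA.1.card_pos
      rwa [div_le_iff₀ hApos] at h1
    choose E hE using compactness J hJ ε hε
    have main : ∀ η : ℝ, 0 < η → η ≤ 1 / 2 → ∀ n : ℕ,
        limsupFolner (fun F =>
          Real.log (sepCount (XJF J F) (thetaInfSep (4 * ε) F)) / (F.card : ℝ)) ≤
        B / (1 - η) + (1 - η / 2) ^ n * Real.log L := by
      intro η hη hη1 n
      obtain ⟨K', δ', hK', hδ', hP⟩ := ornstein_weiss hamen K δ hδ E B (Real.log L) η hB0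
        hlogL hη hη1 n
      refine limsupFolner_le _ (fun F => psi_nonneg _) K' δ' _ hK' hδ' (hamen K' hK' δ' hδ') ?_
      intro F hF
      have hFpos : (0 : ℝ) < F.card := by exact_mod_cast hF.1.card_pos
      rw [div_le_iff₀ hFpos]
      have hLF : ∀ t : Γ, cov (XJF J F) (4 * ε) {t} L := hL _
      refine le_trans ?_ (hP F hF (fun T => Real.log (minCov (XJF J F) (4 * ε) T)) ?_ ?_ ?_ ?_)
      · rcases Nat.eq_zero_or_pos (sepCount (XJF J F) (thetaInfSep (4 * ε) F)) with h | h
        · rw [h]; simpa using Real.log_natCast_nonneg _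
        · apply Real.log_le_log (by exact_mod_cast h)
          exact_mod_cast sepCount_le_of_cov (minCov_spec hLF F)
      · simpa using log_minCov_le hLF (cov_empty (Z := XJF J F) (e := 4 * ε))
      · intro S T
        have hS := minCov_spec hLF S
        have hT := minCov_spec hLF T
        have h1 := log_minCov_le hLF (cov_union hS hT)
        rw [Nat.cast_mul, Real.log_mul] at h1
        · exact h1
        · exact_mod_cast (cov_pos hS).ne'
        · exact_mod_cast (cov_pos hT).ne'
      · intro t
        exact log_minCov_le hLF (hLF t)
      · intro A c hA hc
        exact (log_minCov_le hLF (tile_cov J ε hε A (E A) F (hE A) (hM _) c hc)).trans (hBle A hA)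
    have main2 : ∀ η : ℝ, 0 < η → η ≤ 1 / 2 →
        limsupFolner (fun F =>
          Real.log (sepCount (XJF J F) (thetaInfSep (4 * ε) F)) / (F.card : ℝ)) ≤
        B / (1 - η) := by
      intro η hη hη1
      have ht : Filter.Tendsto (fun n : ℕ => B / (1 - η) + (1 - η / 2) ^ n * Real.log L)
          Filter.atTop (nhds (B / (1 - η) + 0 * Real.log L)) :=
        ((tendsto_pow_atTop_nhds_zero_of_lt_one (by linarith) (by linarith)).mul_const _).const_add _
      rw [zero_mul, add_zero] at ht
      exact ge_of_tendsto' ht (main η hη hη1)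
    have ht : Filter.Tendsto (fun η : ℝ => B / (1 - η)) (nhdsWithin 0 (Set.Ioi 0))
        (nhds (B / (1 - 0))) := by
      apply Filter.Tendsto.mono_left _ nhdsWithin_le_nhds
      apply Filter.Tendsto.div tendsto_const_nhds _ (by norm_num)
      exact tendsto_const_nhds.sub Filter.tendsto_id
    rw [sub_zero, div_one] at ht
    refine ge_of_tendsto ht ?_
    filter_upwards [Ioc_mem_nhdsGT (show (0 : ℝ) < 1 / 2 by norm_num)] with η hη
    exact main2 η hη.1 hη.2
  · refine limsupFolner_mono _ _ (fun F => psi_nonneg _) (Real.log M)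
      (fun F => psi_le hMpos (hM _) _) ?_
    · intro F
      apply div_le_div_of_nonneg_right _ (by positivity)
      have hle : sepCount (XJ J) (thetaInfSep ε F) ≤ sepCount (XJF J F) (thetaInfSep ε F) := by
        apply csSup_le_csSup ⟨_, sep_bdd (exists_cov (hM _) F)⟩ (sep_nonempty F)
        rintro m ⟨W, hW, hs, hc⟩
        exact ⟨W, fun x hx f hf t _ => hW hx f hf t, hs, hc⟩
      rcases Nat.eq_zero_or_pos (sepCount (XJ J) (thetaInfSep ε F)) with h | h
      · rw [h]; simpa using Real.log_natCast_nonneg _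
      · apply Real.log_le_log (by exact_mod_cast h)
        exact_mod_cast hle
end

section
/- Let Γ be a countable discrete group, d ≥ 1, and f ∈ M_d(ℤΓ) with f = f* such that for every nonempty finite subset F' ⊆ Γ the compression f_{F'} is positive definite. Let K ⊆ Γ be the support of f, let 0 < ε < 1 and 0 < κ ≤ 1/2, and set η = εκ/4. Let B ≥ 0 be such that ‖f x‖₂ ≤ B‖x‖₂ for every finitely supported x : Γ → ℂ^d. Then for every nonempty finite subset F ⊆ Γ satisfying B·|K⁻¹F∖F|^{1/2}/2 ≤ η·|F|^{1/2}, one has N_ε(X_f, ϑ_{F,2}) ≤ det(f_F) / D_{f_F, κ}. -/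
open Matrix
open scoped ComplexOrder Pointwise

/-- The compression `f_F` of `f = Σ_s f_s s ∈ M_d(ℤΓ)`: the complex matrix indexed by
`F × {1,…,d}` with entries `f_F((s,i),(t,j)) = (f_{s t⁻¹})_{i,j}`. -/
def intCompression {Γ : Type*} [Group Γ] {d : ℕ} (f : Γ → Matrix (Fin d) (Fin d) ℤ)
    (F : Finset Γ) :
    Matrix ({a // a ∈ F} × Fin d) ({a // a ∈ F} × Fin d) ℂ :=
  Matrix.of fun p q => ((f (p.1.1 * q.1.1⁻¹) p.2 q.2 : ℤ) : ℂ)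

/-- `X_f`: the set of `x ∈ ((ℝ/ℤ)^d)^Γ` annihilated by every row of `f ∈ M_d(ℤΓ)`. -/
def Xf {Γ : Type*} [Group Γ] {d : ℕ} (f : Γ → Matrix (Fin d) (Fin d) ℤ) :
    Set (Γ → Fin d → AddCircle (1 : ℝ)) :=
  {x | ∀ i : Fin d, ∀ t : Γ, ∑ᶠ s : Γ, ∑ j : Fin d, f s i j • x (s⁻¹ * t) j = 0}

/-- `ϑ_{F,2}(x,y) > ε`, where
`ϑ_{F,2}(x,y) = ((1/(d|F|)) Σ_{s∈F} Σ_j ϑ(x_{s,j}, y_{s,j})²)^{1/2}`. -/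
def theta2Sep {Γ : Type*} [Group Γ] (d : ℕ) (ε : ℝ) (F : Finset Γ)
    (x y : Γ → Fin d → AddCircle (1 : ℝ)) : Prop :=
  ε < Real.sqrt ((1 / ((d : ℝ) * F.card)) *
        ∑ s ∈ F, ∑ j : Fin d, (dist (x s j) (y s j)) ^ 2)


open MeasureTheory in
theorem volume_packing {S α : Type*} [Fintype S] [DecidableEq S] (lam : S → ℝ) (κ r : ℝ)
    (hr : 0 < r) (hκ : κ ≤ 1 / 2) (h0 : ∀ i, 0 < lam i) (h1 : ∀ i, lam i ≤ κ)
    (hκ0 : 0 < κ)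
    (W : Finset α) (p : α → EuclideanSpace ℝ S) (c : EuclideanSpace ℝ S)
    (hsep : ∀ x ∈ W, ∀ y ∈ W, x ≠ y → 2 * r ≤ dist (p x) (p y))
    (hc : ∀ x ∈ W, ∑ i, (lam i * p x i - c i) ^ 2 ≤ (κ * r) ^ 2) :
    (W.card : ℝ) * ∏ i, lam i ≤ 1 := by
  let L : EuclideanSpace ℝ S →ₗ[ℝ] EuclideanSpace ℝ S := Matrix.toEuclideanLin (diagonal lam)
  have hL : ∀ x i, L x i = lam i * x i := by
    intro x i
    simp [L, Matrix.toLpLin_apply, mulVec_diagonal]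
  have hdet : LinearMap.det L = ∏ i, lam i := by
    simp only [L, Matrix.toLpLin_eq_toLin, LinearMap.det_toLin, det_diagonal]
  have hprod : 0 < ∏ i, lam i := Finset.prod_pos fun i _ => h0 i
  have hnorm : ∀ x, ‖L x‖ ≤ κ * ‖x‖ := by
    intro x
    rw [EuclideanSpace.norm_eq, EuclideanSpace.norm_eq]
    rw [← Real.sqrt_sq hκ0.le, ← Real.sqrt_mul (sq_nonneg _)]
    apply Real.sqrt_le_sqrt
    rw [Finset.mul_sum]
    refine Finset.sum_le_sum fun i _ => ?_
    rw [hL, norm_mul, mul_pow]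
    have : ‖lam i‖ ^ 2 ≤ κ ^ 2 := by
      rw [Real.norm_of_nonneg (h0 i).le]
      exact pow_le_pow_left₀ (h0 i).le (h1 i) 2
    gcongr
  have hinj : Function.Injective L := by
    intro x y hxy
    ext i
    have := congrArg (fun z : EuclideanSpace ℝ S => z i) hxy
    simp only [hL] at this
    exact mul_left_cancel₀ (h0 i).ne' this
  have hsub : ⋃ x ∈ W, L '' (Metric.ball (p x) r) ⊆ Metric.ball c r := by
    intro z hz
    simp only [Set.mem_iUnion] at hz
    obtain ⟨x, hx, y, hy, rfl⟩ := hz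
    rw [Metric.mem_ball, dist_eq_norm] at hy ⊢
    have e : L y - c = L (y - p x) + (L (p x) - c) := by rw [map_sub]; abel
    have h2 : ‖L (p x) - c‖ ≤ κ * r := by
      rw [EuclideanSpace.norm_eq]
      refine Real.sqrt_le_iff.2 ⟨by positivity, ?_⟩
      simpa [hL] using hc x hx
    calc ‖L y - c‖ ≤ ‖L (y - p x)‖ + ‖L (p x) - c‖ := by rw [e]; exact norm_add_le _ _
      _ ≤ κ * ‖y - p x‖ + κ * r := add_le_add (hnorm _) h2
      _ < κ * r + κ * r := by gcongr
      _ ≤ r := by nlinarith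
  have hdisj : (W : Set α).PairwiseDisjoint (fun x => L '' (Metric.ball (p x) r)) := by
    intro x hx y hy hxy
    refine (Set.disjoint_image_iff hinj).2 ?_
    exact Metric.ball_disjoint_ball (by linarith [hsep x hx y hy hxy])
  have hmeas : ∀ x ∈ W, MeasurableSet (L '' (Metric.ball (p x) r)) := by
    intro x _
    refine IsOpen.measurableSet ?_
    let e := LinearEquiv.ofInjectiveEndo L hinj
    exact e.toContinuousLinearEquiv.toHomeomorph.isOpenMap _ Metric.isOpen_ball
  have hvol := measure_mono (μ := (volume : Measure (EuclideanSpace ℝ S))) hsub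
  rw [measure_biUnion_finset hdisj hmeas] at hvol
  simp only [Measure.addHaar_image_linearMap, hdet, abs_of_pos hprod,
    Measure.addHaar_ball_center _ _ r, Finset.sum_const, nsmul_eq_mul] at hvol
  have hb0 : (volume : Measure (EuclideanSpace ℝ S)) (Metric.ball 0 r) ≠ 0 :=
    (Metric.measure_ball_pos _ _ hr).ne'
  have hb1 : (volume : Measure (EuclideanSpace ℝ S)) (Metric.ball 0 r) ≠ ⊤ :=
    measure_ball_lt_top.ne
  rw [← mul_assoc] at hvol
  have := ENNReal.toReal_mono hb1 hvol
  rw [ENNReal.toReal_mul, ENNReal.toReal_mul, ENNReal.toReal_ofReal hprod.le] at this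
  have hb : 0 < ((volume : Measure (EuclideanSpace ℝ S)) (Metric.ball 0 r)).toReal :=
    ENNReal.toReal_pos hb0 hb1
  simp only [ENNReal.toReal_natCast] at this
  nlinarith

theorem card_quot {ι : Type*} [Fintype ι] [DecidableEq ι] (M : Matrix ι ι ℤ) (h : M.det ≠ 0) :
    Nat.card ((ι → ℤ) ⧸ LinearMap.range (Matrix.toLin' M)) = M.det.natAbs := by
  have hinj : Function.Injective (Matrix.toLin' M) := by
    rw [← LinearMap.ker_eq_bot]
    exact Matrix.ker_toLin'_eq_bot_iff.2 fun v hv => by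
      by_contra hne
      exact h (Matrix.exists_mulVec_eq_zero_iff.1 ⟨v, hne, hv⟩)
  rw [← Submodule.natAbs_det_equiv _ (LinearEquiv.ofInjective _ hinj), ← LinearMap.det_toLin' M]
  congr 2

theorem packing_matrix {ι α : Type*} [Fintype ι] [DecidableEq ι] (M : Matrix ι ι ℤ)
    (hA : (M.map (Int.cast : ℤ → ℝ)).IsHermitian) (hpos : ∀ i, 0 < hA.eigenvalues i)
    (hdet : 0 < M.det) (κ r : ℝ) (hr : 0 < r) (hκ0 : 0 < κ) (hκ : κ ≤ 1 / 2)
    (W : Finset α) (x : α → ι → ℝ) (z : α → ι → ℤ)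
    (hz : ∀ a ∈ W, ∑ i, ((M.map (Int.cast : ℤ → ℝ) *ᵥ x a) i - z a i) ^ 2 ≤ (κ * r) ^ 2)
    (hsep : ∀ a ∈ W, ∀ b ∈ W, a ≠ b → ∀ w : ι → ℤ,
      (4 * r) ^ 2 < ∑ i, (x a i - x b i - w i) ^ 2) :
    (W.card : ℝ) * ∏ i ∈ Finset.univ.filter (fun i => hA.eigenvalues i ≤ κ), hA.eigenvalues i
      ≤ (M.det : ℝ) := by
  classical
  set A := M.map (Int.cast : ℤ → ℝ) with hAdef
  set D := ∏ i ∈ Finset.univ.filter (fun i => hA.eigenvalues i ≤ κ), hA.eigenvalues i with hD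
  have hDpos : 0 < D := Finset.prod_pos fun i _ => hpos i
  let Q := (ι → ℤ) ⧸ LinearMap.range (Matrix.toLin' M)
  have hcard : Nat.card Q = M.det.natAbs := card_quot M hdet.ne'
  have hQfin : Finite Q := Nat.finite_of_card_ne_zero (by rw [hcard]; omega)
  have : Fintype Q := Fintype.ofFinite Q
  let b := hA.eigenvectorBasis
  let lam := hA.eigenvalues
  let co : (ι → ℝ) → ι → ℝ := fun y i => inner ℝ (b i) (WithLp.toLp 2 y)
  have hco_sub : ∀ y y' i, co (y - y') i = co y i - co y' i := by
    intro y y' i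
    simp only [co, WithLp.toLp_sub, inner_sub_right]
  have hco_sq : ∀ y, ∑ i, (co y i) ^ 2 = ∑ i, (y i) ^ 2 := by
    intro y
    have h1 := b.sum_sq_norm_inner_right (WithLp.toLp 2 y)
    rw [EuclideanSpace.norm_sq_eq] at h1
    simpa [co] using h1
  have hco_A : ∀ y i, co (A *ᵥ y) i = lam i * co y i := by
    intro y i
    have h1 := hA.mulVec_eigenvectorBasis i
    have hT : Aᵀ = A := by
      have := hA.eq
      rwa [conjTranspose_eq_transpose_of_trivial] at this
    simp only [co, EuclideanSpace.inner_eq_star_dotProduct, star_trivial]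
    have h2 : (A *ᵥ y) ⬝ᵥ (b i).ofLp = y ⬝ᵥ (A *ᵥ (b i).ofLp) := by
      rw [dotProduct_comm, dotProduct_mulVec, dotProduct_comm]
      conv_lhs => rw [← hT, vecMul_transpose]
    rw [h2, h1, dotProduct_smul, smul_eq_mul]
  let π : α → Q := fun a => Submodule.Quotient.mk (z a)
  have hfib : ∀ q : Q, ((W.filter (fun a => π a = q)).card : ℝ) * D ≤ 1 := by
    intro q
    obtain ⟨zc, rfl⟩ := Submodule.Quotient.mk_surjective _ q
    have hw : ∀ a, ∃ w : ι → ℤ, π a = Submodule.Quotient.mk zc → z a - zc = M *ᵥ w := by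
      intro a
      by_cases h : π a = Submodule.Quotient.mk zc
      · obtain ⟨w, hw⟩ := (Submodule.Quotient.eq _).1 h
        exact ⟨w, fun _ => by rw [← hw, toLin'_apply]⟩
      · exact ⟨0, fun h' => absurd h' h⟩
    choose w hw using hw
    let x' : α → ι → ℝ := fun a => x a - fun i => (w a i : ℝ)
    have hAx' : ∀ a, π a = Submodule.Quotient.mk zc →
        A *ᵥ x' a - (fun i => (zc i : ℝ)) = A *ᵥ x a - fun i => (z a i : ℝ) := by
      intro a ha
      have h1 : A *ᵥ (fun i => (w a i : ℝ)) = fun i => (z a i : ℝ) - zc i := by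
        ext i
        have := congrFun (hw a ha) i
        simp only [Pi.sub_apply] at this
        rw [← Int.cast_sub, this]
        simp [A, mulVec, dotProduct]
      simp only [x', mulVec_sub, h1]
      ext i
      simp only [Pi.sub_apply]
      ring
    let S := {i // lam i ≤ κ}
    have hprod : D = ∏ i : S, lam i.1 := by
      rw [hD]
      exact (Finset.prod_subtype (p := fun i => lam i ≤ κ) _ (by simp [lam]) _)
    have hsubsum : ∀ g : ι → ℝ, ∑ i : S, g i.1 = ∑ i ∈ Finset.univ.filter (fun i => lam i ≤ κ), g i := by
      intro g
      exact (Finset.sum_subtype (p := fun i => lam i ≤ κ) _ (by simp) _).symm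
    rw [hprod]
    refine volume_packing (fun i : S => lam i.1) κ r hr hκ (fun i => hpos i.1) (fun i => i.2) hκ0
      _ (fun a => WithLp.toLp 2 fun i : S => co (x' a) i.1)
      (WithLp.toLp 2 fun i : S => co (fun i => (zc i : ℝ)) i.1) ?_ ?_
    · intro a ha a' ha' hne
      rw [Finset.mem_filter] at ha ha'
      by_contra hlt
      push Not at hlt
      have hs := hsep a ha.1 a' ha'.1 hne (w a - w a')
      have e1 : ∑ i, (x a i - x a' i - ((w a - w a') i : ℤ)) ^ 2 = ∑ i, (co (x' a - x' a') i) ^ 2 := by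
        rw [hco_sq]
        refine Finset.sum_congr rfl fun i _ => ?_
        simp only [x', Pi.sub_apply]
        push_cast
        ring
      rw [e1, ← Finset.sum_filter_add_sum_filter_not _ (fun i => lam i ≤ κ)] at hs
      have hsmall : ∑ i ∈ Finset.univ.filter (fun i => lam i ≤ κ), (co (x' a - x' a') i) ^ 2
          ≤ (2 * r) ^ 2 := by
        rw [← hsubsum (fun i => (co (x' a - x' a') i) ^ 2)]
        rw [EuclideanSpace.dist_eq] at hlt
        have := (Real.sqrt_lt' (by positivity)).1 hlt
        simp only [Real.dist_eq, sq_abs] at this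
        simpa only [hco_sub] using this.le
      have hlarge : κ ^ 2 * ∑ i ∈ Finset.univ.filter (fun i => ¬ lam i ≤ κ),
          (co (x' a - x' a') i) ^ 2 ≤ 4 * (κ * r) ^ 2 := by
        have hAu : ∑ i, (co (A *ᵥ (x' a - x' a')) i) ^ 2 ≤ 4 * (κ * r) ^ 2 := by
          have e2 : A *ᵥ (x' a - x' a') = (A *ᵥ x a - fun i => (z a i : ℝ)) -
              (A *ᵥ x a' - fun i => (z a' i : ℝ)) := by
            rw [← hAx' a ha.2, ← hAx' a' ha'.2, mulVec_sub]; abel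
          rw [hco_sq, e2]
          have h1 := hz a ha.1
          have h2 := hz a' ha'.1
          calc _ ≤ ∑ i, (2 * ((A *ᵥ x a) i - z a i) ^ 2 + 2 * ((A *ᵥ x a') i - z a' i) ^ 2) := by
                refine Finset.sum_le_sum fun i _ => ?_
                simp only [Pi.sub_apply]
                nlinarith [sq_nonneg (((A *ᵥ x a) i - z a i) + ((A *ᵥ x a') i - z a' i))]
            _ = 2 * ∑ i, ((A *ᵥ x a) i - z a i) ^ 2 + 2 * ∑ i, ((A *ᵥ x a') i - z a' i) ^ 2 := by
                rw [Finset.sum_add_distrib, Finset.mul_sum, Finset.mul_sum]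
            _ ≤ _ := by linarith
        refine le_trans ?_ hAu
        rw [Finset.mul_sum]
        refine le_trans ?_ (Finset.sum_le_sum_of_subset_of_nonneg (Finset.subset_univ
          (Finset.univ.filter (fun i => ¬ lam i ≤ κ))) (fun i _ _ => sq_nonneg _))
        refine Finset.sum_le_sum fun i hi => ?_
        rw [hco_A, mul_pow]
        have : κ ^ 2 ≤ lam i ^ 2 := by
          have := (Finset.mem_filter.1 hi).2
          push Not at this
          exact pow_le_pow_left₀ hκ0.le this.le 2
        gcongr
      have hlarge' : ∑ i ∈ Finset.univ.filter (fun i => ¬ lam i ≤ κ),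
          (co (x' a - x' a') i) ^ 2 ≤ 4 * r ^ 2 := by
        have : 0 < κ ^ 2 := by positivity
        refine le_of_mul_le_mul_left ?_ this
        linarith [mul_pow κ r 2]
      nlinarith
    · intro a ha
      rw [Finset.mem_filter] at ha
      have : ∀ i : S, lam i.1 * co (x' a) i.1 - co (fun i => (zc i : ℝ)) i.1
          = co (A *ᵥ x a - fun i => (z a i : ℝ)) i.1 := by
        intro i
        rw [← hAx' a ha.2, hco_sub (A *ᵥ x' a), hco_A (x' a)]
      simp only [this]
      rw [hsubsum (fun i => (co (A *ᵥ x a - fun i => (z a i : ℝ)) i) ^ 2)]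
      refine le_trans (Finset.sum_le_sum_of_subset_of_nonneg (Finset.subset_univ _)
        (fun i _ _ => sq_nonneg _)) ?_
      rw [hco_sq]
      exact hz a ha.1
  have hW : W.card = ∑ q : Q, (W.filter (fun a => π a = q)).card :=
    Finset.card_eq_sum_card_fiberwise (fun a _ => Finset.mem_coe.2 (Finset.mem_univ _))
  rw [hW, Nat.cast_sum, Finset.sum_mul]
  calc _ ≤ ∑ q : Q, (1 : ℝ) := Finset.sum_le_sum fun q _ => hfib q
    _ = (Nat.card Q : ℝ) := by simp
    _ = (M.det : ℝ) := by
      rw [hcard]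
      rw [Nat.cast_natAbs, abs_of_pos hdet]

theorem prod_eigenvalues_eq {ι : Type*} [Fintype ι] [DecidableEq ι] (M : Matrix ι ι ℤ)
    (hC : (M.map (Int.cast : ℤ → ℂ)).IsHermitian) (hA : (M.map (Int.cast : ℤ → ℝ)).IsHermitian) :
    Multiset.map hC.eigenvalues Finset.univ.val = Multiset.map hA.eigenvalues Finset.univ.val := by
  have h1 := hC.roots_charpoly_eq_eigenvalues
  have h2 := hA.roots_charpoly_eq_eigenvalues
  have h3 : (M.map (Int.cast : ℤ → ℂ)).charpoly =
      (M.map (Int.cast : ℤ → ℝ)).charpoly.map (algebraMap ℝ ℂ) := by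
    rw [← Matrix.charpoly_map]
    congr 1
  have h4 : (M.map (Int.cast : ℤ → ℂ)).charpoly.roots =
      (M.map (Int.cast : ℤ → ℝ)).charpoly.roots.map (algebraMap ℝ ℂ) := by
    rw [h3]
    exact (hA.splits_charpoly).roots_map _
  rw [h1, h2] at h4
  apply Multiset.map_injective (f := (fun x : ℝ => (x : ℂ))) Complex.ofReal_injective
  simpa [Multiset.map_map, Function.comp_def] using h4

theorem conv_sum {Γ R : Type*} [Group Γ] [DecidableEq Γ] [CommRing R] {d : ℕ}
    (f : Γ → Matrix (Fin d) (Fin d) ℤ) (K : Finset Γ) (hK : ∀ s : Γ, s ∈ K ↔ f s ≠ 0)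
    (Y : Γ → Fin d → R) (i : Fin d) (t : Γ) (G : Finset Γ) (hG : ∀ s ∈ K, s⁻¹ * t ∈ G) :
    ∑ s ∈ K, ∑ j, (f s i j : R) * Y (s⁻¹ * t) j
      = ∑ u ∈ G, ∑ j, (f (t * u⁻¹) i j : R) * Y u j := by
  have hinj : Function.Injective (fun s : Γ => s⁻¹ * t) := by
    intro a b hab
    simpa using hab
  have h1 : ∑ u ∈ K.image (fun s => s⁻¹ * t), ∑ j, (f (t * u⁻¹) i j : R) * Y u j
      = ∑ s ∈ K, ∑ j, (f s i j : R) * Y (s⁻¹ * t) j := by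
    rw [Finset.sum_image (fun a _ b _ h => hinj h)]
    simp
  rw [← h1]
  apply Finset.sum_subset
  · intro u hu
    obtain ⟨s, hs, rfl⟩ := Finset.mem_image.1 hu
    exact hG s hs
  · intro u _ hu
    have : f (t * u⁻¹) = 0 := by
      by_contra hne
      exact hu (Finset.mem_image.2 ⟨t * u⁻¹, (hK _).2 hne, by simp⟩)
    simp [this]

theorem exists_lift_half : ∃ l : AddCircle (1 : ℝ) → ℝ,
    ∀ a, ((l a : ℝ) : AddCircle (1 : ℝ)) = a ∧ |l a| ≤ 1 / 2 := by
  have : ∀ a : AddCircle (1 : ℝ), ∃ y : ℝ, (y : AddCircle (1 : ℝ)) = a ∧ |y| ≤ 1 / 2 := by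
    intro a
    obtain ⟨y, rfl⟩ := QuotientAddGroup.mk_surjective a
    refine ⟨y - round y, ?_, abs_sub_round y⟩
    rw [AddCircle.coe_sub]
    have : ((round y : ℝ) : AddCircle (1 : ℝ)) = 0 :=
      (AddCircle.coe_eq_zero_iff _).2 ⟨round y, by simp⟩
    rw [this, sub_zero]
  choose l hl using this
  exact ⟨l, hl⟩

theorem dist_le_lift (a b : AddCircle (1 : ℝ)) (y y' : ℝ) (n : ℤ)
    (h : (y : AddCircle (1 : ℝ)) = a) (h' : (y' : AddCircle (1 : ℝ)) = b) :
    dist a b ≤ |y - y' - n| := by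
  have e : a - b = ((y - y' - n : ℝ) : AddCircle (1 : ℝ)) := by
    have : ((n : ℝ) : AddCircle (1 : ℝ)) = 0 := (AddCircle.coe_eq_zero_iff _).2 ⟨n, by simp⟩
    rw [AddCircle.coe_sub, AddCircle.coe_sub, this, h, h', sub_zero]
  rw [dist_eq_norm, e]
  exact QuotientAddGroup.norm_mk_le_norm

theorem prod_filter_eq_of_map_eq {ι : Type*} [Fintype ι] (u v : ι → ℝ) (κ : ℝ)
    (h : Multiset.map u Finset.univ.val = Multiset.map v Finset.univ.val) (hu : ∀ i, 0 < u i) :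
    ∏ i ∈ Finset.univ.filter (fun i => u i ∈ Set.Ioc 0 κ), u i
      = ∏ i ∈ Finset.univ.filter (fun i => v i ≤ κ), v i := by
  classical
  have e : ∀ w : ι → ℝ, ∏ i ∈ Finset.univ.filter (fun i => w i ≤ κ), w i =
      ((Multiset.map w Finset.univ.val).filter (fun y => y ≤ κ)).prod := by
    intro w
    rw [Multiset.filter_map]
    rfl
  rw [e v, ← h, ← e u]
  refine Finset.prod_congr ?_ fun _ _ => rfl
  ext i
  simp [hu i]

theorem boundary_bound {Γ : Type*} [Group Γ] [DecidableEq Γ] (d : ℕ)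
    (f : Γ → Matrix (Fin d) (Fin d) ℤ)
    (K : Finset Γ) (hK : ∀ s : Γ, s ∈ K ↔ f s ≠ 0)
    (B : ℝ) (hB0 : 0 ≤ B)
    (hB : ∀ x : Γ → Fin d → ℂ, (Function.support x).Finite →
      Real.sqrt (∑ᶠ t : Γ, ∑ i : Fin d,
          ‖∑ᶠ s : Γ, ∑ j : Fin d, ((f s i j : ℤ) : ℂ) * x (s⁻¹ * t) j‖ ^ 2) ≤
        B * Real.sqrt (∑ᶠ s : Γ, ∑ j : Fin d, ‖x s j‖ ^ 2))
    (F E : Finset Γ) (g : Γ → Fin d → ℝ) (hg : ∀ u ∉ E, g u = 0)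
    (hg1 : ∀ u j, |g u j| ≤ 1 / 2) :
    Real.sqrt (∑ t ∈ F, ∑ i, (∑ s ∈ K, ∑ j, (f s i j : ℝ) * g (s⁻¹ * t) j) ^ 2) ≤
      B * (Real.sqrt E.card * Real.sqrt d / 2) := by
  let x : Γ → Fin d → ℂ := fun u j => (g u j : ℂ)
  have hx0 : ∀ u ∉ E, x u = 0 := by
    intro u hu
    ext j
    simp [x, hg u hu]
  have hxs : (Function.support x).Finite := E.finite_toSet.subset fun u hu => by
    by_contra h
    exact hu (hx0 u h)
  have hin : ∀ t i, ∑ᶠ s : Γ, ∑ j : Fin d, ((f s i j : ℤ) : ℂ) * x (s⁻¹ * t) j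
      = ((∑ s ∈ K, ∑ j, (f s i j : ℝ) * g (s⁻¹ * t) j : ℝ) : ℂ) := by
    intro t i
    rw [finsum_eq_sum_of_support_subset (s := K)]
    · push_cast
      rfl
    · intro s hs
      rw [Finset.mem_coe, hK]
      intro h0
      exact hs (by simp [h0])
  have h := hB x hxs
  simp only [hin, Complex.norm_real, Real.norm_eq_abs, sq_abs] at h
  have hT : ∀ t ∉ K * E, ∑ i, (∑ s ∈ K, ∑ j, (f s i j : ℝ) * g (s⁻¹ * t) j) ^ 2 = 0 := by
    intro t ht
    refine Finset.sum_eq_zero fun i _ => ?_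
    rw [Finset.sum_eq_zero, sq, zero_mul]
    intro s hs
    have : g (s⁻¹ * t) = 0 := by
      apply hg
      intro hmem
      exact ht (Finset.mem_mul.2 ⟨s, hs, _, hmem, by simp⟩)
    simp [this]
  rw [finsum_eq_sum_of_support_subset (s := F ∪ K * E)] at h
  swap
  · intro t ht
    by_contra hn
    refine ht (hT t fun hm => hn ?_)
    exact Finset.mem_coe.2 (Finset.mem_union_right _ hm)
  refine le_trans (Real.sqrt_le_sqrt ?_) (h.trans (mul_le_mul_of_nonneg_left ?_ hB0))
  · exact Finset.sum_le_sum_of_subset_of_nonneg Finset.subset_union_left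
      (fun t _ _ => Finset.sum_nonneg fun i _ => sq_nonneg _)
  · rw [finsum_eq_sum_of_support_subset (s := E)]
    · refine Real.sqrt_le_iff.2 ⟨by positivity, ?_⟩
      rw [div_pow, mul_pow, Real.sq_sqrt (by positivity), Real.sq_sqrt (by positivity)]
      calc _ ≤ ∑ u ∈ E, ∑ j : Fin d, (1 / 4 : ℝ) := by
            refine Finset.sum_le_sum fun u _ => Finset.sum_le_sum fun j _ => ?_
            have h1 := hg1 u j
            simp only [x, Complex.norm_real, Real.norm_eq_abs]
            nlinarith [abs_nonneg (g u j)]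
        _ = _ := by simp; ring
    · intro u hu
      by_contra hn
      exact hu (by simp [hx0 u hn])

/-- **Lemma 4.8 (upper bound for separation numbers of `X_f`).**
Let `f ∈ M_d(ℤΓ)` be self-adjoint with all compressions positive definite, with support
`K`, let `0 < ε < 1`, `0 < κ ≤ 1/2`, `η = εκ/4`, and let `B ≥ 0` dominate the operator norm
of `f` on `ℓ²(Γ)^d`.  Then for every nonempty finite `F ⊆ Γ` with
`B |K⁻¹F∖F|^{1/2}/2 ≤ η |F|^{1/2}`, one has `N_ε(X_f, ϑ_{F,2}) ≤ det(f_F)/D_{f_F,κ}`,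
where `D_{f_F,κ}` is the product of the eigenvalues of `f_F` in `(0,κ]`. -/
theorem sepCount_Xf_le_det_div_smallEigenvalues
    {Γ : Type*} [Group Γ] [Countable Γ] [DecidableEq Γ]
    (d : ℕ) (hd : 1 ≤ d)
    (f : Γ → Matrix (Fin d) (Fin d) ℤ) (hffin : (Function.support f).Finite)
    (hsa : ∀ s : Γ, f s⁻¹ = (f s)ᵀ)
    (hpos : ∀ F' : Finset Γ, F'.Nonempty → (intCompression f F').PosDef)
    (K : Finset Γ) (hK : ∀ s : Γ, s ∈ K ↔ f s ≠ 0)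
    (ε κ : ℝ) (hε0 : 0 < ε) (hε1 : ε < 1) (hκ0 : 0 < κ) (hκ : κ ≤ 1 / 2)
    (B : ℝ) (hB0 : 0 ≤ B)
    (hB : ∀ x : Γ → Fin d → ℂ, (Function.support x).Finite →
      Real.sqrt (∑ᶠ t : Γ, ∑ i : Fin d,
          ‖∑ᶠ s : Γ, ∑ j : Fin d, ((f s i j : ℤ) : ℂ) * x (s⁻¹ * t) j‖ ^ 2) ≤
        B * Real.sqrt (∑ᶠ s : Γ, ∑ j : Fin d, ‖x s j‖ ^ 2))
    (F : Finset Γ) (hF : F.Nonempty)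
    (hcond : B * Real.sqrt (((K⁻¹ * F) \ F).card) / 2 ≤ ε * κ / 4 * Real.sqrt F.card) :
    ((sepCount (Xf f) (theta2Sep d ε F) : ℕ) : ℝ) ≤
      (intCompression f F).det.re /
        ∏ i ∈ Finset.univ.filter
            (fun i => (hpos F hF).1.eigenvalues i ∈ Set.Ioc 0 κ),
          (hpos F hF).1.eigenvalues i := by
  classical
  let ι := {a // a ∈ F} × Fin d
  let M : Matrix ι ι ℤ := Matrix.of fun p q => f (p.1.1 * q.1.1⁻¹) p.2 q.2
  have hMC : intCompression f F = M.map (Int.cast : ℤ → ℂ) := by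
    ext p q
    simp [intCompression, M]
  have hC : (M.map (Int.cast : ℤ → ℂ)).PosDef := hMC ▸ hpos F hF
  have hA : (M.map (Int.cast : ℤ → ℝ)).IsHermitian := by
    ext p q
    simp only [conjTranspose_apply, map_apply, star_trivial, M, of_apply]
    have := hsa (p.1.1 * q.1.1⁻¹)
    rw [_root_.mul_inv_rev, _root_.inv_inv] at this
    rw [this, transpose_apply]
  have hmap := prod_eigenvalues_eq M hC.1 hA
  have hApos : ∀ i, 0 < hA.eigenvalues i := by
    intro i
    have : hA.eigenvalues i ∈ Multiset.map hC.1.eigenvalues Finset.univ.val := by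
      rw [hmap]
      exact Multiset.mem_map_of_mem _ (Finset.mem_univ_val i)
    obtain ⟨j, _, hj⟩ := Multiset.mem_map.1 this
    rw [← hj]
    exact hC.eigenvalues_pos j
  have hdetC : (intCompression f F).det = ((M.det : ℤ) : ℂ) := by
    rw [hMC]
    exact (Int.cast_det M).symm
  have hdet : 0 < M.det := by
    have := (hpos F hF).det_pos
    rw [hdetC] at this
    exact_mod_cast this
  have hD : ∏ i ∈ Finset.univ.filter (fun i => (hpos F hF).1.eigenvalues i ∈ Set.Ioc 0 κ),
          (hpos F hF).1.eigenvalues i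
      = ∏ i ∈ Finset.univ.filter (fun i => hA.eigenvalues i ≤ κ), hA.eigenvalues i :=
    prod_filter_eq_of_map_eq _ _ κ hmap (hpos F hF).eigenvalues_pos
  have hDpos : 0 < ∏ i ∈ Finset.univ.filter (fun i => hA.eigenvalues i ≤ κ), hA.eigenvalues i :=
    Finset.prod_pos fun i _ => hApos i
  rw [hD, hdetC, Complex.intCast_re]
  obtain ⟨l, hl⟩ := exists_lift_half
  have hN : (0 : ℝ) < F.card := by exact_mod_cast hF.card_pos
  have hd' : (0 : ℝ) < d := by exact_mod_cast hd
  set r : ℝ := ε * (Real.sqrt F.card * Real.sqrt d) / 4 with hrdef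
  have hr : 0 < r := by positivity
  have hr2 : (4 * r) ^ 2 = ε ^ 2 * (d * F.card) := by
    have h1 := Real.sq_sqrt hN.le
    have h2 := Real.sq_sqrt hd'.le
    calc (4 * r) ^ 2 = ε ^ 2 * (Real.sqrt d ^ 2 * Real.sqrt F.card ^ 2) := by rw [hrdef]; ring
      _ = _ := by rw [h1, h2]
  have key : ∀ W : Finset (Γ → Fin d → AddCircle (1 : ℝ)), ↑W ⊆ Xf f →
      (∀ x ∈ W, ∀ y ∈ W, x ≠ y → theta2Sep d ε F x y) →
      (W.card : ℝ) ≤ (M.det : ℝ) /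
        ∏ i ∈ Finset.univ.filter (fun i => hA.eigenvalues i ≤ κ), hA.eigenvalues i := by
    intro W hWX hWsep
    rw [le_div_iff₀ hDpos]
    have hz : ∀ x : Γ → Fin d → AddCircle (1 : ℝ), ∃ z : ι → ℤ, x ∈ Xf f → ∀ p : ι,
        ∑ s ∈ K, ∑ j, (f s p.2 j : ℝ) * l (x (s⁻¹ * p.1.1) j) = z p := by
      intro x
      by_cases hx : x ∈ Xf f
      · have : ∀ p : ι, ∃ n : ℤ,
            ∑ s ∈ K, ∑ j, (f s p.2 j : ℝ) * l (x (s⁻¹ * p.1.1) j) = n := by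
          intro p
          have h := hx p.2 p.1.1
          rw [finsum_eq_sum_of_support_subset (s := K)] at h
          swap
          · intro s hs
            rw [Finset.mem_coe, hK]
            intro h0
            exact hs (by simp [h0])
          have h2 : ((∑ s ∈ K, ∑ j, (f s p.2 j : ℝ) * l (x (s⁻¹ * p.1.1) j) : ℝ) :
              AddCircle (1 : ℝ)) = 0 := by
            rw [← h]
            have hom : ∀ y : ℝ, (y : AddCircle (1 : ℝ)) =
              QuotientAddGroup.mk' (AddSubgroup.zmultiples (1 : ℝ)) y := fun _ => rfl
            rw [hom, map_sum]
            refine Finset.sum_congr rfl fun s _ => ?_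
            rw [map_sum]
            refine Finset.sum_congr rfl fun j _ => ?_
            rw [← zsmul_eq_mul, map_zsmul, ← hom, (hl _).1]
          obtain ⟨n, hn⟩ := (AddCircle.coe_eq_zero_iff _).1 h2
          exact ⟨n, by rw [← hn]; simp⟩
        choose z hz using this
        exact ⟨z, fun _ => hz⟩
      · exact ⟨0, fun h => absurd h hx⟩
    choose z hz using hz
    refine packing_matrix M hA hApos hdet κ r hr hκ0 hκ W
      (fun x p => l (x p.1.1 p.2)) z ?_ ?_
    · intro x hxW
      have hx := hWX hxW
      let E := (K⁻¹ * F) \ F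
      let y : Γ → Fin d → ℝ := fun u j => l (x u j)
      let g : Γ → Fin d → ℝ := fun u j => if u ∈ E then l (x u j) else 0
      have hb := boundary_bound d f K hK B hB0 hB F E g
        (fun u hu => by ext j; simp [g, hu])
        (fun u j => by
          by_cases hu : u ∈ E
          · simpa [g, hu] using (hl (x u j)).2
          · simp [g, hu])
      have heq : ∀ p : ι, ((M.map (Int.cast : ℤ → ℝ)) *ᵥ (fun q : ι => l (x q.1.1 q.2))) p - z x p
          = - ∑ s ∈ K, ∑ j, (f s p.2 j : ℝ) * g (s⁻¹ * p.1.1) j := by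
        intro p
        have hG : ∀ s ∈ K, s⁻¹ * p.1.1 ∈ F ∪ E := by
          intro s hs
          have h1 : s⁻¹ * p.1.1 ∈ K⁻¹ * F :=
            Finset.mul_mem_mul (Finset.inv_mem_inv hs) p.1.2
          by_cases h2 : s⁻¹ * p.1.1 ∈ F
          · exact Finset.mem_union_left _ h2
          · exact Finset.mem_union_right _ (Finset.mem_sdiff.2 ⟨h1, h2⟩)
        have hdisj : Disjoint F E := Finset.disjoint_sdiff
        rw [← hz x hx p, conv_sum f K hK y p.2 p.1.1 _ hG, conv_sum f K hK g p.2 p.1.1 _ hG,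
          Finset.sum_union hdisj, Finset.sum_union hdisj]
        have h1 : ∑ u ∈ F, ∑ j, (f (p.1.1 * u⁻¹) p.2 j : ℝ) * g u j = 0 := by
          refine Finset.sum_eq_zero fun u hu => Finset.sum_eq_zero fun j _ => ?_
          have : u ∉ E := fun h => (Finset.mem_sdiff.1 h).2 hu
          simp [g, this]
        have h2 : ∑ u ∈ E, ∑ j, (f (p.1.1 * u⁻¹) p.2 j : ℝ) * g u j
            = ∑ u ∈ E, ∑ j, (f (p.1.1 * u⁻¹) p.2 j : ℝ) * y u j := by
          refine Finset.sum_congr rfl fun u hu => Finset.sum_congr rfl fun j _ => ?_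
          simp [g, hu, y]
        have h3 : ((M.map (Int.cast : ℤ → ℝ)) *ᵥ (fun q : ι => l (x q.1.1 q.2))) p
            = ∑ u ∈ F, ∑ j, (f (p.1.1 * u⁻¹) p.2 j : ℝ) * y u j := by
          rw [← Finset.sum_coe_sort F]
          simp only [mulVec, dotProduct]
          rw [Fintype.sum_prod_type]
          rfl
        rw [h1, h2, h3]
        ring
      simp only [heq, neg_sq]
      rw [Fintype.sum_prod_type]
      rw [Finset.sum_coe_sort F
        (fun t => ∑ i, (∑ s ∈ K, ∑ j, (f s i j : ℝ) * g (s⁻¹ * t) j) ^ 2)]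
      refine (Real.sqrt_le_left (by positivity)).1 (hb.trans ?_)
      calc B * (Real.sqrt E.card * Real.sqrt d / 2)
          = (B * Real.sqrt E.card / 2) * Real.sqrt d := by ring
        _ ≤ (ε * κ / 4 * Real.sqrt F.card) * Real.sqrt d := by gcongr
        _ = κ * r := by rw [hrdef]; ring
    · intro x hx y hy hxy w
      have h := hWsep x hx y hy hxy
      unfold theta2Sep at h
      rw [Real.lt_sqrt hε0.le, one_div, ← div_eq_inv_mul, lt_div_iff₀ (by positivity)] at h
      rw [hr2]
      refine h.trans_le ?_
      rw [Fintype.sum_prod_type, ← Finset.sum_coe_sort F]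
      refine Finset.sum_le_sum fun s _ => Finset.sum_le_sum fun j _ => ?_
      rw [← sq_abs (l _ - l _ - _)]
      exact pow_le_pow_left₀ dist_nonneg
        (dist_le_lift _ _ _ _ (w (s, j)) (hl _).1 (hl _).1) 2
  have hmem := Nat.sSup_mem (s := {n : ℕ | ∃ W : Finset (Γ → Fin d → AddCircle (1 : ℝ)),
      ↑W ⊆ Xf f ∧ (∀ x ∈ W, ∀ y ∈ W, x ≠ y → theta2Sep d ε F x y) ∧ W.card = n})
    ⟨0, ∅, by simp, by simp, by simp⟩
    ⟨⌊(M.det : ℝ) /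
        ∏ i ∈ Finset.univ.filter (fun i => hA.eigenvalues i ≤ κ), hA.eigenvalues i⌋₊, by
      rintro n ⟨W, h1, h2, rfl⟩
      exact Nat.le_floor (key W h1 h2)⟩
  obtain ⟨W, h1, h2, h3⟩ := hmem
  unfold sepCount
  rw [← h3]
  exact key W h1 h2
end

section
/- Let Γ be a countable discrete amenable group, d ≥ 1, and f ∈ M_d(ℤΓ). Then the following are equivalent: (1) there exists a nonzero square-summable function x : Γ → ℂ^d (i.e. Σ_{s∈Γ} ‖x(s)‖² < ∞) such that Σ_{s∈Γ} f_s x(s⁻¹t) = 0 for all t ∈ Γ; (2) there exists a nonzero square-summable function y : Γ → ℂ^d such that Σ_{s∈Γ} (f*)_s y(s⁻¹t) = 0 for all t ∈ Γ; (3) there exists a nonzero g ∈ M_d(ℤΓ) with fg = 0. -/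
open Matrix

theorem aux_trace_rank {n : Type*} [Fintype n] [DecidableEq n] (B : Matrix n n ℂ) :
    ‖B.trace‖ ^ 2 ≤ B.rank * ∑ j, ∑ i, ‖B i j‖ ^ 2 := by
  set e := (WithLp.linearEquiv 2 ℂ (n → ℂ)).symm with he
  set R : Submodule ℂ (EuclideanSpace ℂ n) :=
    (Submodule.span ℂ (Set.range B.col)).map e.toLinearMap with hR
  have hr : Module.finrank ℂ R = B.rank := by
    rw [Matrix.rank_eq_finrank_span_cols]
    exact LinearEquiv.finrank_map_eq e _
  set b := stdOrthonormalBasis ℂ R with hb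
  let v : n → R := fun j => ⟨e (B.col j), Submodule.mem_map_of_mem (Submodule.subset_span ⟨j, rfl⟩)⟩
  have h1 : ∀ j, B j j = ∑ k, inner ℂ (b k) (v j) * (b k : EuclideanSpace ℂ n) j := by
    intro j
    have h := congrArg (fun z : R => (z : EuclideanSpace ℂ n) j) (b.sum_repr' (v j))
    simp only [Submodule.coe_sum, Submodule.coe_smul, WithLp.ofLp_sum, Finset.sum_apply,
      WithLp.ofLp_smul, Pi.smul_apply, smul_eq_mul] at h
    rw [h]
    rfl
  have h2 : ∀ j, ∑ k, ‖inner ℂ (b k) (v j)‖ ^ 2 = ∑ i, ‖B i j‖ ^ 2 := by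
    intro j
    rw [b.sum_sq_norm_inner_right, ← Submodule.norm_coe, EuclideanSpace.norm_sq_eq]
    rfl
  have h3 : ∑ j, ∑ k, ‖(b k : EuclideanSpace ℂ n) j‖ ^ 2 = B.rank := by
    rw [Finset.sum_comm]
    have : ∀ k, ∑ j, ‖(b k : EuclideanSpace ℂ n) j‖ ^ 2 = 1 := by
      intro k
      rw [← EuclideanSpace.norm_sq_eq, Submodule.norm_coe, b.norm_eq_one]; norm_num
    simp [this, hr]
  calc ‖B.trace‖ ^ 2
      = ‖∑ p : n × _, inner ℂ (b p.2) (v p.1) * (b p.2 : EuclideanSpace ℂ n) p.1‖ ^ 2 := by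
        rw [Matrix.trace, Fintype.sum_prod_type]; simp only [Matrix.diag, h1]
    _ ≤ (∑ p : n × _, ‖inner ℂ (b p.2) (v p.1)‖ * ‖(b p.2 : EuclideanSpace ℂ n) p.1‖) ^ 2 := by
        gcongr
        refine (norm_sum_le _ _).trans (le_of_eq ?_)
        simp only [norm_mul]
    _ ≤ _ := Finset.sum_mul_sq_le_sq_mul_sq _ _ _
    _ = _ := by
        rw [Fintype.sum_prod_type, Fintype.sum_prod_type, h3, mul_comm]
        simp only [h2]

theorem aux_int_kernel {m n : Type*} [Fintype m] [Fintype n] [DecidableEq n]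
    (C : Matrix m n ℤ) (w : n → ℂ) (hw : w ≠ 0) (h : (C.map (Int.cast : ℤ → ℂ)) *ᵥ w = 0) :
    ∃ v : n → ℤ, v ≠ 0 ∧ C *ᵥ v = 0 := by
  have h0 : ((Cᵀ * C).map (Int.cast : ℤ → ℂ)) *ᵥ w = 0 := by
    have : (Cᵀ * C).map (Int.cast : ℤ → ℂ) = Cᵀ.map (Int.cast : ℤ → ℂ) * C.map (Int.cast : ℤ → ℂ) :=
      Matrix.map_mul (f := Int.castRingHom ℂ)
    rw [this, ← Matrix.mulVec_mulVec, h, Matrix.mulVec_zero]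
  have h1 : ((Cᵀ * C).map (Int.cast : ℤ → ℂ)).det = 0 :=
    Matrix.exists_mulVec_eq_zero_iff.1 ⟨w, hw, h0⟩
  have h2 : (Cᵀ * C).det = 0 := by
    have := (Int.castRingHom ℂ).map_det (Cᵀ * C)
    have h3 : (((Cᵀ * C).det : ℤ) : ℂ) = 0 := this.trans h1
    exact_mod_cast h3
  obtain ⟨v, hv, hv'⟩ := Matrix.exists_mulVec_eq_zero_iff.2 h2
  refine ⟨v, hv, ?_⟩
  rw [← dotProduct_self_eq_zero]
  rw [← Matrix.mulVec_mulVec] at hv'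
  have := congrArg (fun z => v ⬝ᵥ z) hv'
  simp only [dotProduct_zero] at this
  rw [Matrix.dotProduct_mulVec, Matrix.vecMul_transpose] at this
  exact this

theorem aux_rank_rows {m m1 m2 n : Type*} [Fintype m] [Fintype m1] [Fintype m2] [Fintype n]
    (A : Matrix m n ℂ) (A1 : Matrix m1 n ℂ) (D : Matrix m2 n ℂ)
    (h : ∀ i, (∃ k, A i = A1 k) ∨ ∃ k, A i = D k) :
    A.rank ≤ A1.rank + Fintype.card m2 := by
  rw [Matrix.rank_eq_finrank_span_row, Matrix.rank_eq_finrank_span_row]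
  have h1 : Submodule.span ℂ (Set.range A.row) ≤
      Submodule.span ℂ (Set.range A1.row) ⊔ Submodule.span ℂ (Set.range D.row) := by
    rw [Submodule.span_le]
    rintro _ ⟨i, rfl⟩
    rcases h i with ⟨k, hk⟩ | ⟨k, hk⟩
    · exact Submodule.mem_sup_left (Submodule.subset_span ⟨k, hk.symm⟩)
    · exact Submodule.mem_sup_right (Submodule.subset_span ⟨k, hk.symm⟩)
  calc _ ≤ _ := Submodule.finrank_mono h1
    _ ≤ _ := Submodule.finrank_add_le_finrank_add_finrank _ _
    _ ≤ _ := by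
      gcongr
      exact finrank_range_le_card _

theorem aux_exists_ker {m n : Type*} [Fintype m] [Fintype n] (C : Matrix m n ℂ)
    (h : C.rank < Fintype.card n) : ∃ w : n → ℂ, w ≠ 0 ∧ C *ᵥ w = 0 := by
  have h1 := LinearMap.finrank_range_add_finrank_ker C.mulVecLin
  rw [Module.finrank_fintype_fun_eq_card] at h1
  have h2 : C.rank = Module.finrank ℂ (LinearMap.range C.mulVecLin) := rfl
  have h3 : LinearMap.ker C.mulVecLin ≠ ⊥ := by
    intro h4
    rw [h4, finrank_bot] at h1
    omega
  obtain ⟨w, hw, hw0⟩ := Submodule.exists_mem_ne_zero_of_ne_bot h3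
  exact ⟨w, hw0, hw⟩

theorem aux_finsum {Γ M : Type*} [Group Γ] [AddCommMonoid M] (F : Finset Γ) (t : Γ) (h : Γ → M)
    (hF : ∀ s, h s ≠ 0 → s⁻¹ * t ∈ F) : ∑ᶠ s, h s = ∑ u : F, h (t * (u : Γ)⁻¹) := by
  rw [← finsum_comp_equiv ((Equiv.inv Γ).trans (Equiv.mulLeft t))]
  rw [finsum_eq_sum_of_support_subset (s := F), ← Finset.sum_coe_sort]
  · rfl
  · intro u hu
    have := hF _ hu
    simpa using this

theorem aux_key {Γ : Type*} [Group Γ] [DecidableEq Γ]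
    (hamen : ∀ K : Finset Γ, K.Nonempty → ∀ δ : ℝ, 0 < δ → ∃ F : Finset Γ, memApproxInv K δ F)
    (d : ℕ) (f : Γ → Matrix (Fin d) (Fin d) ℤ) (hffin : (Function.support f).Finite)
    (x : Γ → Fin d → ℂ) (hx0 : x ≠ 0) (hx : Summable (fun s => ∑ j : Fin d, ‖x s j‖ ^ 2))
    (hfx : ∀ t : Γ, ∑ᶠ s : Γ, ((f s).map (fun a : ℤ => (a : ℂ))).mulVec (x (s⁻¹ * t)) = 0) :
    ∃ w : Γ → Fin d → ℤ, (Function.support w).Finite ∧ w ≠ 0 ∧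
      ∀ t : Γ, ∑ᶠ s : Γ, ((f s⁻¹)ᵀ).mulVec (w (s⁻¹ * t)) = 0 := by
  obtain ⟨s0, hs0⟩ := Function.ne_iff.1 hx0
  obtain ⟨i0, hi0⟩ := Function.ne_iff.1 hs0
  simp only [Pi.zero_apply] at hi0
  set a : ℝ := ‖x s0 i0‖ ^ 2 with ha
  have hapos : 0 < a := by positivity
  set N : ℝ := ∑' s, ∑ j : Fin d, ‖x s j‖ ^ 2 with hN
  have hsumle : ∀ P : Finset Γ, ∑ s ∈ P, ‖x s i0‖ ^ 2 ≤ N := by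
    intro P
    refine le_trans (Finset.sum_le_sum (fun s _ => ?_)) (hx.sum_le_tsum P (fun s _ => by positivity))
    exact Finset.single_le_sum (f := fun j => ‖x s j‖ ^ 2) (fun j _ => by positivity)
      (Finset.mem_univ i0)
  have hNpos : 0 < N := lt_of_lt_of_le hapos (by simpa [ha] using hsumle {s0})
  set S := hffin.toFinset with hS
  have hSmem : ∀ s, s ∈ S ↔ f s ≠ 0 := by intro s; simp [hS]
  set K : Finset Γ := insert 1 (S ∪ S.image (·⁻¹)) with hK
  have hKS : ∀ s, f s ≠ 0 → s⁻¹ ∈ K := by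
    intro s hs
    have := (hSmem s).2 hs
    simp [hK, this]
  have hK1 : (1 : Γ) ∈ K := by simp [hK]
  set δ : ℝ := a / (N * (d * (1 + K.card) + 1)) with hδ
  have hδpos : 0 < δ := by positivity
  obtain ⟨F, hFne, hF⟩ := hamen K ⟨1, hK1⟩ δ hδpos
  set I := F.filter fun t => ∀ k ∈ K, k * t ∈ F with hI
  have hIF : I ⊆ F := Finset.filter_subset _ _
  have hbd : ((F \ I).card : ℝ) ≤ δ * F.card := by
    rw [Finset.cast_card_sdiff hIF]; linarith
  set T : Finset Γ := (K ×ˢ F).image (fun p => p.1 * p.2) with hT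
  have hTmem : ∀ k ∈ K, ∀ u ∈ F, k * u ∈ T := fun k hk u hu =>
    Finset.mem_image.2 ⟨(k, u), Finset.mem_product.2 ⟨hk, hu⟩, rfl⟩
  have hTF : ((T \ F).card : ℝ) ≤ K.card * (δ * F.card) := by
    have h1 : T \ F ⊆ (K ×ˢ (F \ I)).image (fun p => p.1 * p.2) := by
      intro t ht
      rw [Finset.mem_sdiff, hT, Finset.mem_image] at ht
      obtain ⟨⟨⟨k, u⟩, hku, rfl⟩, hnot⟩ := ht
      rw [Finset.mem_product] at hku
      refine Finset.mem_image.2 ⟨(k, u), Finset.mem_product.2 ⟨hku.1, ?_⟩, rfl⟩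
      refine Finset.mem_sdiff.2 ⟨hku.2, fun hu => hnot ?_⟩
      exact (Finset.mem_filter.1 hu).2 k hku.1
    have h2 : (T \ F).card ≤ K.card * (F \ I).card :=
      (Finset.card_le_card h1).trans (Finset.card_image_le.trans (Finset.card_product _ _).le)
    calc ((T \ F).card : ℝ) ≤ K.card * (F \ I).card := by exact_mod_cast h2
      _ ≤ _ := by gcongr
  -- the matrices
  let A : Matrix (F × Fin d) (F × Fin d) ℂ :=
    fun p q => ((f ((p.1 : Γ) * (q.1 : Γ)⁻¹) p.2 q.2 : ℤ) : ℂ)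
  let A1 : Matrix (I × Fin d) (F × Fin d) ℂ :=
    fun p q => ((f ((p.1 : Γ) * (q.1 : Γ)⁻¹) p.2 q.2 : ℤ) : ℂ)
  let D1 : Matrix ((F \ I : Finset Γ) × Fin d) (F × Fin d) ℂ :=
    fun p q => ((f ((p.1 : Γ) * (q.1 : Γ)⁻¹) p.2 q.2 : ℤ) : ℂ)
  let E : Matrix (F × Fin d) F ℂ := fun p g => x ((p.1 : Γ) * (g : Γ)⁻¹ * s0) p.2
  let B : Matrix F F ℂ := fun t g => x ((t : Γ) * (g : Γ)⁻¹ * s0) i0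
  let C : Matrix (T × Fin d) (F × Fin d) ℤ :=
    fun p q => f ((q.1 : Γ) * (p.1 : Γ)⁻¹) q.2 p.2
  let D2 : Matrix ((T \ F : Finset Γ) × Fin d) (F × Fin d) ℂ :=
    fun p q => ((f ((q.1 : Γ) * (p.1 : Γ)⁻¹) q.2 p.2 : ℤ) : ℂ)
  have hFpos : (0 : ℝ) < F.card := by exact_mod_cast hFne.card_pos
  -- rank of B
  have hB : a * F.card ≤ B.rank * N := by
    have h1 := aux_trace_rank B
    have h2 : B.trace = F.card * x s0 i0 := by
      simp [Matrix.trace, B, Matrix.diag]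
    have h3 : ∑ j, ∑ i, ‖B i j‖ ^ 2 ≤ F.card * N := by
      have : ∀ j : F, ∑ i, ‖B i j‖ ^ 2 ≤ N := by
        intro j
        refine le_trans (le_of_eq ?_) (hsumle (F.map ⟨fun t => t * (j : Γ)⁻¹ * s0, fun u v huv => by
          simpa using huv⟩))
        rw [Finset.sum_map]
        exact Finset.sum_coe_sort F (fun t => ‖x (t * (j : Γ)⁻¹ * s0) i0‖ ^ 2)
      calc _ ≤ ∑ j : F, N := Finset.sum_le_sum (fun j _ => this j)
        _ = _ := by simp
    have h4 : ‖B.trace‖ ^ 2 = F.card * (a * F.card) := by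
      rw [h2, norm_mul, mul_pow, ha]; simp; ring
    have h5 : (F.card : ℝ) * (a * F.card) ≤ F.card * (B.rank * N) := by
      rw [← h4]
      refine h1.trans ?_
      calc _ ≤ (B.rank : ℝ) * (F.card * N) := by gcongr
        _ = _ := by ring
    exact le_of_mul_le_mul_left h5 hFpos
  have hBE : B.rank ≤ E.rank := by
    have : B = E.submatrix (fun t => (t, i0)) id := rfl
    rw [this]
    exact Matrix.rank_submatrix_le _ _ _
  have hAE : A1 * E = 0 := by
    ext ⟨⟨t, ht⟩, i⟩ ⟨g, hg⟩
    have h1 := congrFun (hfx (t * g⁻¹ * s0)) i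
    rw [aux_finsum F t] at h1
    · rw [Finset.sum_apply, Pi.zero_apply] at h1
      rw [Matrix.mul_apply, Fintype.sum_prod_type, Matrix.zero_apply, ← h1]
      refine Finset.sum_congr rfl fun u _ => ?_
      simp [Matrix.mulVec, dotProduct, A1, E, mul_assoc]
    · intro s hs
      refine (Finset.mem_filter.1 ht).2 _ (hKS s fun h0 => hs ?_)
      rw [h0]; ext; simp [Matrix.mulVec, dotProduct]
  have hr1 := Matrix.rank_add_rank_le_card_of_mul_eq_zero hAE
  have hr2 : A.rank ≤ A1.rank + Fintype.card ((F \ I : Finset Γ) × Fin d) := by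
    refine aux_rank_rows A A1 D1 ?_
    rintro ⟨⟨t, ht⟩, i⟩
    by_cases h : t ∈ I
    · exact Or.inl ⟨(⟨t, h⟩, i), rfl⟩
    · exact Or.inr ⟨(⟨t, Finset.mem_sdiff.2 ⟨ht, h⟩⟩, i), rfl⟩
  have hr3 : (C.map (Int.cast : ℤ → ℂ)).rank ≤
      Aᵀ.rank + Fintype.card ((T \ F : Finset Γ) × Fin d) := by
    refine aux_rank_rows _ Aᵀ D2 ?_
    rintro ⟨⟨t, ht⟩, i⟩
    by_cases h : t ∈ F
    · exact Or.inl ⟨(⟨t, h⟩, i), rfl⟩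
    · exact Or.inr ⟨(⟨t, Finset.mem_sdiff.2 ⟨ht, h⟩⟩, i), rfl⟩
  rw [Matrix.rank_transpose] at hr3
  have hlt : ((F \ I).card * d + (T \ F).card * d : ℝ) < E.rank := by
    have h1 : ((F \ I).card * d + (T \ F).card * d : ℝ) ≤ (d * (1 + K.card)) * (δ * F.card) := by
      nlinarith [Nat.cast_nonneg (α := ℝ) d]
    have h2 : (d * (1 + K.card)) * (δ * F.card) < (d * (1 + K.card) + 1) * (δ * F.card) := by
      have : 0 < δ * F.card := by positivity
      linarith
    have h3 : (d * (1 + K.card) + 1) * (δ * F.card) = a * F.card / N := by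
      rw [hδ]; field_simp
    have h4 : a * F.card / N ≤ B.rank := by rw [div_le_iff₀ hNpos]; exact hB
    have h5 : (B.rank : ℝ) ≤ E.rank := by exact_mod_cast hBE
    linarith
  have hCr : (C.map (Int.cast : ℤ → ℂ)).rank < Fintype.card (F × Fin d) := by
    have h1 : (F \ I).card * d + (T \ F).card * d < E.rank := by exact_mod_cast hlt
    simp only [Fintype.card_prod, Fintype.card_coe, Fintype.card_fin] at hr1 hr2 hr3 ⊢
    omega
  obtain ⟨w0, hw0, hCw0⟩ := aux_exists_ker _ hCr
  obtain ⟨v, hv, hCv⟩ := aux_int_kernel C w0 hw0 hCw0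
  set w : Γ → Fin d → ℤ := fun u j => if h : u ∈ F then v (⟨u, h⟩, j) else 0 with hw
  have hwF : ∀ u, u ∉ F → w u = 0 := by
    intro u hu; funext j; simp [hw, hu]
  refine ⟨w, ?_, ?_, ?_⟩
  · refine F.finite_toSet.subset ?_
    intro u hu
    by_contra h
    exact hu (hwF u h)
  · intro h
    apply hv
    funext ⟨⟨u, hu⟩, j⟩
    have := congrFun (congrFun h u) j
    simpa [hw, hu] using this
  · intro t
    rw [aux_finsum F t]
    · by_cases ht : t ∈ T
      · funext i
        have h1 := congrFun hCv (⟨t, ht⟩, i)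
        simp only [Matrix.mulVec, dotProduct, Fintype.sum_prod_type, Pi.zero_apply] at h1
        rw [Finset.sum_apply, Pi.zero_apply, ← h1]
        refine Finset.sum_congr rfl fun u _ => ?_
        simp [Matrix.mulVec, dotProduct, C, hw]
      · refine Finset.sum_eq_zero fun u _ => ?_
        have : f (t * (u : Γ)⁻¹)⁻¹ = 0 := by
          by_contra h
          apply ht
          have := hTmem _ (hKS _ h) u u.2
          simpa using this
        rw [this]; simp
    · intro s hs
      by_contra h
      apply hs
      rw [hwF _ h, Matrix.mulVec_zero]

theorem aux_cast {Γ : Type*} [Group Γ] (d : ℕ) (f : Γ → Matrix (Fin d) (Fin d) ℤ)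
    (hffin : (Function.support f).Finite) (w : Γ → Fin d → ℤ) (hwfin : (Function.support w).Finite)
    (hw : w ≠ 0) (h : ∀ t : Γ, ∑ᶠ s : Γ, (f s).mulVec (w (s⁻¹ * t)) = 0) :
    ∃ x : Γ → Fin d → ℂ, x ≠ 0 ∧ Summable (fun s => ∑ j : Fin d, ‖x s j‖ ^ 2) ∧
      ∀ t : Γ, ∑ᶠ s : Γ, ((f s).map (fun a : ℤ => (a : ℂ))).mulVec (x (s⁻¹ * t)) = 0 := by
  refine ⟨fun s j => (w s j : ℂ), ?_, ?_, ?_⟩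
  · intro h0
    apply hw
    funext s j
    have := congrFun (congrFun h0 s) j
    simpa using this
  · refine summable_of_finite_support (hwfin.subset ?_)
    intro s hs h0
    apply hs
    simp [h0]
  · intro t
    have h1 := h t
    rw [finsum_eq_sum_of_support_subset (s := hffin.toFinset)] at h1 ⊢
    · funext i
      have h2 := congrArg (Int.cast : ℤ → ℂ) (congrFun h1 i)
      simpa [Finset.sum_apply, Matrix.mulVec, dotProduct] using h2
    · intro s hs
      simp only [Set.Finite.coe_toFinset]
      intro h0
      apply hs
      ext
      simp [h0, Matrix.mulVec, dotProduct]
    · intro s hs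
      simp only [Set.Finite.coe_toFinset]
      intro h0
      apply hs
      simp [h0]

/-- **Proposition 4.16 (zero divisors and `ℓ²`-kernels).**
Let `Γ` be a countable discrete amenable group and `f ∈ M_d(ℤΓ)`.  The following are
equivalent: (1) `f` has a nonzero square-summable kernel vector; (2) `f*` has a nonzero
square-summable kernel vector; (3) `f g = 0` for some nonzero `g ∈ M_d(ℤΓ)`. -/
theorem kernel_iff_kernel_star_iff_zero_divisor
    {Γ : Type*} [Group Γ] [Countable Γ] [DecidableEq Γ]
    (hamen : ∀ K : Finset Γ, K.Nonempty → ∀ δ : ℝ, 0 < δ → ∃ F : Finset Γ, memApproxInv K δ F)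
    (d : ℕ) (hd : 1 ≤ d)
    (f : Γ → Matrix (Fin d) (Fin d) ℤ) (hffin : (Function.support f).Finite) :
    ((∃ x : Γ → Fin d → ℂ, x ≠ 0 ∧ Summable (fun s => ∑ j : Fin d, ‖x s j‖ ^ 2) ∧
        ∀ t : Γ, ∑ᶠ s : Γ, ((f s).map (fun a : ℤ => (a : ℂ))).mulVec (x (s⁻¹ * t)) = 0) ↔
      (∃ y : Γ → Fin d → ℂ, y ≠ 0 ∧ Summable (fun s => ∑ j : Fin d, ‖y s j‖ ^ 2) ∧
        ∀ t : Γ, ∑ᶠ s : Γ, (((f s⁻¹)ᵀ).map (fun a : ℤ => (a : ℂ))).mulVec (y (s⁻¹ * t)) = 0)) ∧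
    ((∃ y : Γ → Fin d → ℂ, y ≠ 0 ∧ Summable (fun s => ∑ j : Fin d, ‖y s j‖ ^ 2) ∧
        ∀ t : Γ, ∑ᶠ s : Γ, (((f s⁻¹)ᵀ).map (fun a : ℤ => (a : ℂ))).mulVec (y (s⁻¹ * t)) = 0) ↔
      (∃ g : Γ → Matrix (Fin d) (Fin d) ℤ, (Function.support g).Finite ∧ g ≠ 0 ∧
        ∀ t : Γ, ∑ᶠ s : Γ, f s * g (s⁻¹ * t) = 0)) := by
  have hffin' : (Function.support fun s => (f s⁻¹)ᵀ).Finite := by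
    refine (hffin.image (·⁻¹)).subset ?_
    intro s hs
    refine ⟨s⁻¹, fun h0 => hs ?_, inv_inv s⟩
    simp [h0]
  have h12 : (∃ x : Γ → Fin d → ℂ, x ≠ 0 ∧ Summable (fun s => ∑ j : Fin d, ‖x s j‖ ^ 2) ∧
        ∀ t : Γ, ∑ᶠ s : Γ, ((f s).map (fun a : ℤ => (a : ℂ))).mulVec (x (s⁻¹ * t)) = 0) →
      (∃ y : Γ → Fin d → ℂ, y ≠ 0 ∧ Summable (fun s => ∑ j : Fin d, ‖y s j‖ ^ 2) ∧
        ∀ t : Γ, ∑ᶠ s : Γ,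
          (((f s⁻¹)ᵀ).map (fun a : ℤ => (a : ℂ))).mulVec (y (s⁻¹ * t)) = 0) := by
    rintro ⟨x, hx0, hx, hfx⟩
    obtain ⟨w, hwfin, hw0, hw⟩ := aux_key hamen d f hffin x hx0 hx hfx
    exact aux_cast d (fun s => (f s⁻¹)ᵀ) hffin' w hwfin hw0 hw
  have h2w : (∃ y : Γ → Fin d → ℂ, y ≠ 0 ∧ Summable (fun s => ∑ j : Fin d, ‖y s j‖ ^ 2) ∧
        ∀ t : Γ, ∑ᶠ s : Γ,
          (((f s⁻¹)ᵀ).map (fun a : ℤ => (a : ℂ))).mulVec (y (s⁻¹ * t)) = 0) →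
      ∃ w : Γ → Fin d → ℤ, (Function.support w).Finite ∧ w ≠ 0 ∧
        ∀ t : Γ, ∑ᶠ s : Γ, (f s).mulVec (w (s⁻¹ * t)) = 0 := by
    rintro ⟨x, hx0, hx, hfx⟩
    obtain ⟨w, hwfin, hw0, hw⟩ := aux_key hamen d (fun s => (f s⁻¹)ᵀ) hffin' x hx0 hx hfx
    refine ⟨w, hwfin, hw0, ?_⟩
    simpa only [inv_inv, Matrix.transpose_transpose] using hw
  have hsub : ∀ {M : Type} [AddCommMonoid M] (h : Γ → M), (∀ s, f s = 0 → h s = 0) →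
      ∑ᶠ s, h s = ∑ s ∈ hffin.toFinset, h s := by
    intro M _ h hh
    refine finsum_eq_sum_of_support_subset _ ?_
    intro s hs
    simp only [Set.Finite.coe_toFinset]
    exact fun h0 => hs (hh s h0)
  refine ⟨⟨h12, fun h => ?_⟩, fun h => ?_, ?_⟩
  · obtain ⟨w, hwfin, hw0, hw⟩ := h2w h
    exact aux_cast d f hffin w hwfin hw0 hw
  · obtain ⟨w, hwfin, hw0, hw⟩ := h2w h
    refine ⟨fun s => Matrix.of fun i _ => w s i, ?_, ?_, ?_⟩
    · refine hwfin.subset fun s hs h0 => hs ?_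
      ext i j
      simp [h0]
    · intro h0
      apply hw0
      funext s i
      exact congrFun (congrFun (congrFun h0 s) i) ⟨0, hd⟩
    · intro t
      have h1 := hw t
      rw [hsub _ (fun s h0 => by simp [h0])] at h1 ⊢
      ext i j
      have h2 := congrFun h1 i
      simpa [Matrix.sum_apply, Finset.sum_apply, Matrix.mulVec, dotProduct, Matrix.mul_apply] using h2
  · rintro ⟨g, hgfin, hg0, hg⟩
    obtain ⟨s0, hs0⟩ := Function.ne_iff.1 hg0
    have : ∃ i j, g s0 i j ≠ 0 := by
      by_contra hcon
      push Not at hcon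
      exact hs0 (by ext i j; exact hcon i j)
    obtain ⟨i, j, hij⟩ := this
    refine h12 (aux_cast d f hffin (fun s i => g s i j) ?_ ?_ ?_)
    · refine hgfin.subset fun s hs h0 => hs ?_
      funext i
      simp [h0]
    · intro h0
      exact hij (congrFun (congrFun h0 s0) i)
    · intro t
      have h1 := hg t
      rw [hsub _ (fun s h0 => by simp [h0])] at h1 ⊢
      funext i
      have h2 := congrFun (congrFun h1 i) j
      simpa [Matrix.sum_apply, Finset.sum_apply, Matrix.mulVec, dotProduct, Matrix.mul_apply] using h2
end
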